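/- No linear (straight-edge) embedding of K_{3,3,1} in R^3 contains more than five nontrivial 2-component links; combined with realizability of 1 through 5, a linear embedding of K_{3,3,1} contains exactly n nontrivial 2-component links if and only if n ∈ {1,2,3,4,5}. -/

import Mathlib

open scoped Classical

noncomputable section

/-- Points of `ℝ³`. -/
abbrev E3 := EuclideanSpace ℝ (Fin 3)

/-- The determinant of the three vectors `a, b, c` of `ℝ³`. -/
def det3 (a b c : E3) : ℝ :=
  a 0 * (b 1 * c 2 - b 2 * c 1) - a 1 * (b 0 * c 2 - b 2 * c 0) +
    a 2 * (b 0 * c 1 - b 1 * c 0)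

/-- The open flat triangular disk with vertices `A`, `B`, `C`. -/
def OpenTri (A B C : E3) : Set E3 :=
  {x | ∃ a b c : ℝ, 0 < a ∧ 0 < b ∧ 0 < c ∧ a + b + c = 1 ∧
    x = a • A + b • B + c • C}

/-- The segment `XY` pierces the open triangular disk `ABC`. -/
def Pierces (A B C X Y : E3) : Prop :=
  (openSegment ℝ X Y ∩ OpenTri A B C).Nonempty

/-- The signed intersection of the segment `XY` with the triangle `ABC`:
`±1` if `XY` pierces the open disk of `ABC` (the sign recording on which side of
the plane of `ABC` the point `X` lies), and `0` otherwise. -/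
def edgeSign (A B C X Y : E3) : ℤ :=
  if Pierces A B C X Y then
    (if 0 < det3 (B - A) (C - A) (X - A) then 1 else -1) else 0

/-- The linking number of the straight-edge triangle `ABC` with the straight-edge
quadrilateral `DEFG`: the signed count of intersections of the edges of the
quadrilateral with the flat disk bounded by the triangle. -/
def lkTriQuad (A B C D E F G : E3) : ℤ :=
  edgeSign A B C D E + edgeSign A B C E F + edgeSign A B C F G + edgeSign A B C G D

/-- Seven points in general position: no four of them are coplanar. -/
def GenPos7 (v : Fin 7 → E3) : Prop :=
  ∀ i j k l : Fin 7, i ≠ j → i ≠ k → i ≠ l → j ≠ k → j ≠ l → k ≠ l →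
    AffineIndependent ℝ ![v i, v j, v k, v l]

/-- The closed polygonal triangle (1-complex) with vertices `A`, `B`, `C`. -/
def cycle3 (A B C : E3) : Set E3 :=
  segment ℝ A B ∪ segment ℝ B C ∪ segment ℝ C A

/-- The closed polygonal quadrilateral with vertices `D`, `E`, `F`, `G`. -/
def cycle4 (D E F G : E3) : Set E3 :=
  segment ℝ D E ∪ segment ℝ E F ∪ segment ℝ F G ∪ segment ℝ G D

/-- A two-component link `(K, L)` in `ℝ³` is split (trivial): there is an ambient
isotopy of `ℝ³` (a continuous family of homeomorphisms starting at the identity,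
with continuously varying inverses) moving `K` and `L` to opposite sides of a
plane. -/
def SplitLink (K L : Set E3) : Prop :=
  ∃ H : ℝ → (E3 ≃ₜ E3),
    Continuous (fun q : ℝ × E3 => H q.1 q.2) ∧
    Continuous (fun q : ℝ × E3 => (H q.1).symm q.2) ∧
    (∀ x, H 0 x = x) ∧
    (∀ x ∈ K, H 1 x 0 < 0) ∧ (∀ x ∈ L, 0 < H 1 x 0)

/-- Vertices of `K₃,₃,₁` are `0,…,6`: part `{0,2,4}` (labels `1,3,5`), part
`{1,3,5}` (labels `2,4,6`), and the extra vertex `6` (label `7`). -/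
def odds : Fin 3 → Fin 7 := ![0, 2, 4]

/-- The second part of `K₃,₃`. -/
def evens : Fin 3 → Fin 7 := ![1, 3, 5]

/-- The triangle of the link indexed by `(a, b)`: vertex `7` together with the
`a`-th vertex of the first part and the `b`-th vertex of the second part. -/
def triOf (v : Fin 7 → E3) (a b : Fin 3) : Set E3 :=
  cycle3 (v 6) (v (odds a)) (v (evens b))

/-- The quadrilateral complementary to the triangle indexed by `(a, b)`: the
4-cycle on the remaining four vertices of `K₃,₃`. -/
def quadOf (v : Fin 7 → E3) (a b : Fin 3) : Set E3 :=
  cycle4 (v (odds (a + 1))) (v (evens (b + 1))) (v (odds (a + 2))) (v (evens (b + 2)))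

/-- The linking number (as a signed integer) of the triangle indexed by `(a, b)`
with its complementary quadrilateral. -/
def lk331 (v : Fin 7 → E3) (a b : Fin 3) : ℤ :=
  lkTriQuad (v 6) (v (odds a)) (v (evens b))
    (v (odds (a + 1))) (v (evens (b + 1))) (v (odds (a + 2))) (v (evens (b + 2)))

/-- The number of nontrivial (nonsplit) 2-component links among the nine
triangle/quadrilateral pairs of a linear embedding of `K₃,₃,₁`. -/
def linkCount (v : Fin 7 → E3) : ℕ :=
  (Finset.univ.filter fun p : Fin 3 × Fin 3 =>
    ¬ SplitLink (triOf v p.1 p.2) (quadOf v p.1 p.2)).card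

/-- Orientation determinant of four points. -/
def o4 (p q r s : E3) : ℝ := det3 (q - p) (r - p) (s - p)

lemma det3_eq_det (a b c : E3) : det3 a b c = Matrix.det (Matrix.of ![(a : Fin 3 → ℝ), b, c]) := by
  rw [Matrix.det_fin_three]
  simp [det3]
  ring

lemma linInd_iff_det3 (a b c : E3) : LinearIndependent ℝ ![a, b, c] ↔ det3 a b c ≠ 0 := by
  rw [det3_eq_det]
  have h1 : LinearIndependent ℝ ![a, b, c] ↔
      LinearIndependent ℝ (![(a : Fin 3 → ℝ), b, c] : Fin 3 → (Fin 3 → ℝ)) := by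
    rw [← LinearMap.linearIndependent_iff (WithLp.linearEquiv 2 ℝ (Fin 3 → ℝ)).toLinearMap
      (by simp)]
    have : (⇑(WithLp.linearEquiv 2 ℝ (Fin 3 → ℝ)).toLinearMap ∘ ![a, b, c]) =
        (![(a : Fin 3 → ℝ), b, c] : Fin 3 → (Fin 3 → ℝ)) := by
      funext i
      fin_cases i <;> rfl
    rw [this]
  rw [h1, ← isUnit_iff_ne_zero, ← Matrix.isUnit_iff_isUnit_det, ← Matrix.linearIndependent_rows_iff_isUnit]
  rfl

lemma affInd_iff_o4 (p q r s : E3) : AffineIndependent ℝ ![p, q, r, s] ↔ o4 p q r s ≠ 0 := by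
  rw [affineIndependent_iff_linearIndependent_vsub ℝ _ (0 : Fin 4), o4, ← linInd_iff_det3]
  rw [← linearIndependent_equiv (finSuccAboveEquiv (0 : Fin 4))]
  have : ((fun i : { x // x ≠ (0 : Fin 4) } => (![p, q, r, s] i -ᵥ ![p, q, r, s] 0 : E3)) ∘
      ⇑(finSuccAboveEquiv (0 : Fin 4))) = ![q - p, r - p, s - p] := by
    funext i
    fin_cases i <;> rfl
  rw [this]

lemma o4_swap_pairs (p q r s : E3) : o4 r s p q = o4 p q r s := by
  simp only [o4, det3, PiLp.sub_apply]; ring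
lemma o4_swap12 (p q r s : E3) : o4 q p r s = - o4 p q r s := by
  simp only [o4, det3, PiLp.sub_apply]; ring
lemma o4_swap23 (p q r s : E3) : o4 p r q s = - o4 p q r s := by
  simp only [o4, det3, PiLp.sub_apply]; ring
lemma o4_swap34 (p q r s : E3) : o4 p q s r = - o4 p q r s := by
  simp only [o4, det3, PiLp.sub_apply]; ring

/-- affine combination in last slot -/
lemma o4_comb2 (p q r x y : E3) (s t : ℝ) (h : s + t = 1) :
    o4 p q r (s • x + t • y) = s * o4 p q r x + t * o4 p q r y := by
  obtain rfl : t = 1 - s := by linarith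
  simp only [o4, det3, PiLp.sub_apply, PiLp.add_apply, PiLp.smul_apply, smul_eq_mul]; ring

lemma o4_comb3 (p q r x y z : E3) (a b c : ℝ) (h : a + b + c = 1) :
    o4 p q r (a • x + b • y + c • z) = a * o4 p q r x + b * o4 p q r y + c * o4 p q r z := by
  obtain rfl : c = 1 - a - b := by linarith
  simp only [o4, det3, PiLp.sub_apply, PiLp.add_apply, PiLp.smul_apply, smul_eq_mul]; ring

lemma o4_self34 (p q r : E3) : o4 p q r r = 0 := by
  simp only [o4, det3, PiLp.sub_apply]; ring
lemma o4_self24 (p q r : E3) : o4 p q r q = 0 := by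
  simp only [o4, det3, PiLp.sub_apply]; ring
lemma o4_self14 (p q r : E3) : o4 p q r p = 0 := by
  simp only [o4, det3, PiLp.sub_apply]; ring

/-- Radon relation, coefficients. -/
lemma radon_coeff (A B C X Y : E3) :
    o4 X Y B C + o4 X Y C A + o4 X Y A B = o4 A B C Y - o4 A B C X := by
  simp only [o4, det3, PiLp.sub_apply]; ring

/-- Radon relation, points. -/
lemma radon_pt (A B C X Y : E3) :
    o4 X Y B C • A + o4 X Y C A • B + o4 X Y A B • C = o4 A B C Y • X - o4 A B C X • Y := by
  ext i
  fin_cases i <;> simp [o4, det3, PiLp.sub_apply] <;> ring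

/-- Sign bit. -/
def sb (x : ℝ) : Bool := decide (0 < x)

lemma sb_neg {x : ℝ} (h : x ≠ 0) : sb (-x) = !sb x := by
  unfold sb
  rcases lt_or_gt_of_ne h with h | h
  · have h1 : 0 < -x := by linarith
    have h2 : ¬ 0 < x := by linarith
    simp [h1, h2]
  · have h1 : ¬ 0 < -x := by linarith
    simp [h]; linarith

/-- The closed flat triangle. -/
def ClosedTri (A B C : E3) : Set E3 :=
  {x | ∃ a b c : ℝ, 0 ≤ a ∧ 0 ≤ b ∧ 0 ≤ c ∧ a + b + c = 1 ∧
    x = a • A + b • B + c • C}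

/-- the linear relations forced by an intersection point -/
lemma meet_rel {A B C X Y : E3} {s t a b c : ℝ} (hst : s + t = 1) (habc : a + b + c = 1)
    (h : s • X + t • Y = a • A + b • B + c • C) :
    s * o4 A B C X + t * o4 A B C Y = 0 ∧ b * o4 X Y A B = c * o4 X Y C A ∧
    a * o4 X Y C A = b * o4 X Y B C ∧ c * o4 X Y B C = a * o4 X Y A B := by
  have h0 := o4_comb2 A B C X Y s t hst
  rw [h, o4_comb3 _ _ _ _ _ _ _ _ _ habc, o4_self14, o4_self24, o4_self34] at h0
  have h1 := o4_comb2 X Y A X Y s t hst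
  rw [h, o4_comb3 _ _ _ _ _ _ _ _ _ habc, o4_self14, o4_self24, o4_self34, o4_swap34 X Y C A] at h1
  have h2 := o4_comb2 X Y B X Y s t hst
  rw [h, o4_comb3 _ _ _ _ _ _ _ _ _ habc, o4_self14, o4_self24, o4_self34, o4_swap34 X Y A B] at h2
  have h3 := o4_comb2 X Y C X Y s t hst
  rw [h, o4_comb3 _ _ _ _ _ _ _ _ _ habc, o4_self14, o4_self24, o4_self34, o4_swap34 X Y B C] at h3
  refine ⟨?_, ?_, ?_, ?_⟩ <;> linarith

lemma closed_meet_pierces {A B C X Y : E3} (hX : o4 A B C X ≠ 0) (hY : o4 A B C Y ≠ 0)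
    (h1 : o4 X Y B C ≠ 0) (h2 : o4 X Y C A ≠ 0) (h3 : o4 X Y A B ≠ 0)
    (h : (segment ℝ X Y ∩ ClosedTri A B C).Nonempty) : Pierces A B C X Y := by
  obtain ⟨x, ⟨s, t, hs, ht, hst, rfl⟩, a, b, c, ha, hb, hc, habc, he⟩ := h
  obtain ⟨e0, e1, e2, e3⟩ := meet_rel hst habc he
  have hs' : s ≠ 0 := by
    rintro rfl
    have : t = 1 := by linarith
    subst this; apply hY; linarith
  have ht' : t ≠ 0 := by
    rintro rfl
    have : s = 1 := by linarith
    subst this; apply hX; linarith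
  have ha' : a ≠ 0 := by
    rintro rfl
    have hb0 : b = 0 := by
      have : b * o4 X Y B C = 0 := by linarith
      exact (mul_eq_zero.1 this).resolve_right h1
    have hc0 : c = 0 := by
      have : c * o4 X Y B C = 0 := by linarith
      exact (mul_eq_zero.1 this).resolve_right h1
    linarith
  have hb' : b ≠ 0 := by
    rintro rfl
    have : a * o4 X Y C A = 0 := by linarith
    exact ha' ((mul_eq_zero.1 this).resolve_right h2)
  have hc' : c ≠ 0 := by
    rintro rfl
    have : a * o4 X Y A B = 0 := by linarith
    exact ha' ((mul_eq_zero.1 this).resolve_right h3)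
  exact ⟨_, ⟨s, t, lt_of_le_of_ne hs hs'.symm, lt_of_le_of_ne ht ht'.symm, hst, rfl⟩,
    a, b, c, lt_of_le_of_ne ha ha'.symm, lt_of_le_of_ne hb hb'.symm, lt_of_le_of_ne hc hc'.symm, habc, he⟩

lemma pos_iff_of_mul_eq {a b x y : ℝ} (ha : 0 < a) (hb : 0 < b) (h : a * x = b * y) :
    0 < x ↔ 0 < y := by
  constructor
  · intro hx
    by_contra hy
    have := mul_pos ha hx
    nlinarith
  · intro hx
    by_contra hy
    have := mul_pos hb hx
    nlinarith

lemma pierces_iff {A B C X Y : E3} (hX : o4 A B C X ≠ 0) (hY : o4 A B C Y ≠ 0)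
    (h1 : o4 X Y B C ≠ 0) (h2 : o4 X Y C A ≠ 0) (h3 : o4 X Y A B ≠ 0) :
    Pierces A B C X Y ↔ (0 < o4 A B C X ↔ ¬ 0 < o4 A B C Y) ∧
      (0 < o4 X Y A B ↔ 0 < o4 X Y B C) ∧ (0 < o4 X Y B C ↔ 0 < o4 X Y C A) := by
  constructor
  · rintro ⟨x, ⟨s, t, hs, ht, hst, rfl⟩, a, b, c, ha, hb, hc, habc, he⟩
    obtain ⟨e0, e1, e2, e3⟩ := meet_rel hst habc he
    refine ⟨?_, ?_, ?_⟩
    · have : s * o4 A B C X = t * (- o4 A B C Y) := by linarith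
      rw [pos_iff_of_mul_eq hs ht this]
      constructor
      · intro h; linarith
      · intro h
        have := lt_of_le_of_ne (not_lt.1 h) hY
        linarith
    · exact (pos_iff_of_mul_eq hc ha e3).symm
    · exact (pos_iff_of_mul_eq ha hb e2).symm
  · rintro ⟨g0, g1, g2⟩
    have hsum := radon_coeff A B C X Y
    have hpt := radon_pt A B C X Y
    set α := o4 X Y B C
    set β := o4 X Y C A
    set γ := o4 X Y A B
    set p := o4 A B C X
    set q := o4 A B C Y
    have key : 0 < α / (q - p) ∧ 0 < β / (q - p) ∧ 0 < γ / (q - p) ∧ 0 < q / (q - p) ∧ 0 < -p / (q - p) := by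
      by_cases hp : 0 < p
      · have hq : q < 0 := lt_of_le_of_ne (not_lt.1 (g0.1 hp)) hY
        have hα : α < 0 := by
          by_contra hα
          have hα' : 0 < α := lt_of_le_of_ne (not_lt.1 hα) (Ne.symm h1)
          have := g1.2 hα'
          have := g2.1 hα'
          linarith
        have hβ : β < 0 := lt_of_le_of_ne (not_lt.1 (fun h => by have := g2.2 h; linarith)) h2
        have hγ : γ < 0 := lt_of_le_of_ne (not_lt.1 (fun h => by have := g1.1 h; linarith)) h3
        have hd : q - p < 0 := by linarith
        exact ⟨div_pos_of_neg_of_neg hα hd, div_pos_of_neg_of_neg hβ hd, div_pos_of_neg_of_neg hγ hd,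
          div_pos_of_neg_of_neg hq hd, div_pos_of_neg_of_neg (by linarith) hd⟩
      · have hp' : p < 0 := lt_of_le_of_ne (not_lt.1 hp) hX
        have hq : 0 < q := by
          by_contra hq
          exact hp (g0.2 hq)
        have hα : 0 < α := by
          by_contra hα
          have hβ := not_lt.1 (fun h => hα (g2.2 h))
          have hγ := not_lt.1 (fun h => hα (g1.1 h))
          have := not_lt.1 hα
          linarith
        have hβ : 0 < β := g2.1 hα
        have hγ : 0 < γ := g1.2 hα
        have hd : 0 < q - p := by linarith
        exact ⟨div_pos hα hd, div_pos hβ hd, div_pos hγ hd, div_pos hq hd, div_pos (by linarith) hd⟩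
    obtain ⟨k1, k2, k3, k4, k5⟩ := key
    have hd : q - p ≠ 0 := by
      intro h
      rw [h] at k1
      simp at k1
    refine ⟨_, ⟨q / (q - p), -p / (q - p), k4, k5, by field_simp; ring, rfl⟩,
      α / (q - p), β / (q - p), γ / (q - p), k1, k2, k3, by field_simp; linarith, ?_⟩
    have := congrArg (fun z => (q - p)⁻¹ • z) hpt
    simp only [smul_add, smul_sub, smul_smul] at this
    simp only [div_eq_mul_inv]
    rw [mul_comm α, mul_comm β, mul_comm γ, this]
    module

/-- coded signed intersection: `1` none, `2` positive, `0` negative. -/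
def ev (p q u v w : Bool) : ℕ :=
  bif (xor p q && !(xor u v) && !(xor v w)) then (bif p then 2 else 0) else 1

lemma edgeSign_eq {A B C X Y : E3} (hX : o4 A B C X ≠ 0) (hY : o4 A B C Y ≠ 0)
    (h1 : o4 X Y B C ≠ 0) (h2 : o4 X Y C A ≠ 0) (h3 : o4 X Y A B ≠ 0) :
    edgeSign A B C X Y = (ev (sb (o4 A B C X)) (sb (o4 A B C Y)) (sb (o4 X Y A B))
      (sb (o4 X Y B C)) (sb (o4 X Y C A)) : ℤ) - 1 := by
  have key := pierces_iff hX hY h1 h2 h3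
  have hd : det3 (B - A) (C - A) (X - A) = o4 A B C X := rfl
  unfold edgeSign
  rw [hd]
  unfold ev sb
  by_cases hP : Pierces A B C X Y
  · have := key.1 hP
    rw [if_pos hP]
    clear key hd
    by_cases a1 : 0 < o4 A B C X <;> by_cases a2 : 0 < o4 A B C Y <;> by_cases a3 : 0 < o4 X Y A B <;>
      by_cases a4 : 0 < o4 X Y B C <;> by_cases a5 : 0 < o4 X Y C A <;>
      first | (exfalso; simp [a1, a2, a3, a4, a5] at this; done) | simp [a1, a2, a3, a4, a5]
  · have := fun h => hP (key.2 h)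
    rw [if_neg hP]
    clear key hd
    by_cases a1 : 0 < o4 A B C X <;> by_cases a2 : 0 < o4 A B C Y <;> by_cases a3 : 0 < o4 X Y A B <;>
      by_cases a4 : 0 < o4 X Y B C <;> by_cases a5 : 0 < o4 X Y C A <;>
      first | (exfalso; simp [a1, a2, a3, a4, a5] at this; done) | simp [a1, a2, a3, a4, a5]

/-- Boolean quantifier over `Bool`. -/
def allB (f : Bool → Bool) : Bool := f true && f false
/-- Boolean implication. -/
def imp (c r : Bool) : Bool := bif c then r else true

lemma allB_iff (f : Bool → Bool) : allB f = true ↔ ∀ b, f b = true := by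
  unfold allB
  rw [Bool.and_eq_true]
  exact ⟨fun h b => by cases b; exacts [h.2, h.1], fun h => ⟨h _, h _⟩⟩

lemma imp_iff (c r : Bool) : imp c r = true ↔ (c = true → r = true) := by
  cases c <;> simp [imp]

/-- not all equal -/
def nae3 (a b c : Bool) : Bool := xor a b || xor b c
/-- not all equal -/
def nae5 (a b c d e : Bool) : Bool := xor a b || (xor b c || (xor c d || xor d e))

/-- Coded sum of the four signed intersections in a cell (balanced value is `4`). -/
def cellN (t20 t21 t22 t10 t11 t12 u01 u11 u21 u02 u12 u22 d11 d12 d21 d22 : Bool) : ℕ :=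
  Nat.add (Nat.add (ev (!t20) u02 t21 (!d22) u12) (ev u02 t10 (!t11) d12 u22))
    (Nat.add (ev t10 (!u01) (!t12) (!d11) (!u21)) (ev (!u01) (!t20) t22 d21 (!u11)))

/-- `1` if the cell is linked, `0` otherwise. -/
def cellB (t20 t21 t22 t10 t11 t12 u01 u11 u21 u02 u12 u22 d11 d12 d21 d22 : Bool) : ℕ :=
  bif Nat.beq (cellN t20 t21 t22 t10 t11 t12 u01 u11 u21 u02 u12 u22 d11 d12 d21 d22) 4 then 0 else 1

/-- between 1 and 5 -/
def inR (n : ℕ) : Bool := Nat.ble 1 n && Nat.ble n 5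

/-- nine bits -/
abbrev B9 := Bool × Bool × Bool × Bool × Bool × Bool × Bool × Bool × Bool

/-- comparison of bit patterns -/
def eq9 (a b c d e f g h i : Bool) (r : B9) : Bool :=
  !(xor r.1 a) && (!(xor r.2.1 b) && (!(xor r.2.2.1 c) && (!(xor r.2.2.2.1 d) &&
  (!(xor r.2.2.2.2.1 e) && (!(xor r.2.2.2.2.2.1 f) && (!(xor r.2.2.2.2.2.2.1 g) &&
  (!(xor r.2.2.2.2.2.2.2.1 h) && !(xor r.2.2.2.2.2.2.2.2 i))))))))

lemma xn_iff (x a : Bool) : (!(xor x a)) = true ↔ x = a := by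
  cases x <;> cases a <;> decide

lemma eq9_spec (a b c d e f g h i : Bool) (r : B9) (hr : eq9 a b c d e f g h i r = true) :
    r = (a, b, c, d, e, f, g, h, i) := by
  obtain ⟨r1, r2, r3, r4, r5, r6, r7, r8, r9⟩ := r
  simp only [eq9, Bool.and_eq_true, xn_iff] at hr
  simp only [hr]

/-- representatives of sign patterns modulo cyclic shifts and negation -/
def repsL : List B9 :=
  [(false, false, false, false, false, false, false, false, false),
   (false, false, false, false, false, false, false, false, true),
   (false, false, false, false, false, false, false, true, true),
   (false, false, false, false, false, false, true, true, true),
   (false, false, false, false, false, true, false, false, true),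
   (false, false, false, false, false, true, false, true, false),
   (false, false, false, false, false, true, false, true, true),
   (false, false, false, false, false, true, true, false, false),
   (false, false, false, false, false, true, true, false, true),
   (false, false, false, false, false, true, true, true, false),
   (false, false, false, false, false, true, true, true, true),
   (false, false, false, false, true, true, false, false, true),
   (false, false, false, false, true, true, false, true, false),
   (false, false, false, false, true, true, false, true, true),
   (false, false, false, false, true, true, true, false, false),
   (false, false, false, false, true, true, true, false, true),
   (false, false, false, false, true, true, true, true, false),
   (false, false, false, false, true, true, true, true, true),
   (false, false, true, false, false, true, false, false, true),
   (false, false, true, false, false, true, false, true, false),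
   (false, false, true, false, false, true, false, true, true),
   (false, false, true, false, false, true, true, false, false),
   (false, false, true, false, false, true, true, false, true),
   (false, false, true, false, false, true, true, true, false),
   (false, false, true, false, true, false, false, true, true),
   (false, false, true, false, true, false, true, false, false),
   (false, false, true, false, true, false, true, false, true),
   (false, false, true, false, true, false, true, true, false),
   (false, false, true, false, true, true, false, true, false),
   (false, false, true, true, false, false, false, true, false),
   (false, false, true, true, false, false, false, true, true),
   (false, false, true, true, false, false, true, true, false)]

/-- membership in the list of representatives -/
def isRep (a b c d e f g h i : Bool) : Bool := repsL.any (eq9 a b c d e f g h i)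

/-- the finite check -/
def chkT (t00 t01 t02 t10 t11 t12 t20 t21 t22 : Bool) : Bool :=
  allB fun u00 =>
  allB fun u01 =>
  allB fun u02 =>
  imp (nae3 (xor t10 u00) (xor t11 u01) (xor t12 u02)) <|
  imp (nae3 (xor t20 u00) (xor t21 u01) (xor t22 u02)) <|
  allB fun u10 =>
  allB fun u11 =>
  allB fun u12 =>
  imp (nae3 (xor t00 u10) (xor t01 u11) (xor t02 u12)) <|
  imp (nae3 (xor t20 u10) (xor t21 u11) (xor t22 u12)) <|
  allB fun u20 =>
  allB fun u21 =>
  allB fun u22 =>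
  imp (nae3 (xor t00 u20) (xor t01 u21) (xor t02 u22)) <|
  imp (nae3 (xor t10 u20) (xor t11 u21) (xor t12 u22)) <|
  imp (nae3 (xor t01 u00) (xor t11 u10) (xor t21 u20)) <|
  imp (nae3 (xor t02 u00) (xor t12 u10) (xor t22 u20)) <|
  imp (nae3 (xor t00 u01) (xor t10 u11) (xor t20 u21)) <|
  imp (nae3 (xor t02 u01) (xor t12 u11) (xor t22 u21)) <|
  imp (nae3 (xor t00 u02) (xor t10 u12) (xor t20 u22)) <|
  imp (nae3 (xor t01 u02) (xor t11 u12) (xor t21 u22)) <|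
  allB fun d00 =>
  imp (nae5 d00 t01 (!t02) u10 (!u20)) <|
  allB fun d01 =>
  imp (nae5 d01 t02 (!t00) u11 (!u21)) <|
  allB fun d02 =>
  imp (nae5 d02 t00 (!t01) u12 (!u22)) <|
  imp (nae3 (xor t00 d00) (xor t01 d01) (xor t02 d02)) <|
  allB fun d10 =>
  imp (nae5 d10 t11 (!t12) u20 (!u00)) <|
  allB fun d11 =>
  imp (nae5 d11 t12 (!t10) u21 (!u01)) <|
  allB fun d12 =>
  imp (nae5 d12 t10 (!t11) u22 (!u02)) <|
  imp (nae3 (xor t10 d10) (xor t11 d11) (xor t12 d12)) <|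
  allB fun d20 =>
  imp (nae5 d20 t21 (!t22) u00 (!u10)) <|
  allB fun d21 =>
  imp (nae5 d21 t22 (!t20) u01 (!u11)) <|
  allB fun d22 =>
  imp (nae5 d22 t20 (!t21) u02 (!u12)) <|
  imp (nae3 (xor t20 d20) (xor t21 d21) (xor t22 d22)) <|
  imp (nae3 (xor u00 d00) (xor u10 d10) (xor u20 d20)) <|
  imp (nae3 (xor u01 d01) (xor u11 d11) (xor u21 d21)) <|
  imp (nae3 (xor u02 d02) (xor u12 d12) (xor u22 d22)) <|
    inR (Nat.add (cellB t20 t21 t22 t10 t11 t12 u01 u11 u21 u02 u12 u22 d11 d12 d21 d22) (Nat.add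
    (cellB t21 t22 t20 t11 t12 t10 u02 u12 u22 u00 u10 u20 d12 d10 d22 d20) (Nat.add (cellB t22
    t20 t21 t12 t10 t11 u00 u10 u20 u01 u11 u21 d10 d11 d20 d21) (Nat.add (cellB t00 t01 t02 t20
    t21 t22 u11 u21 u01 u12 u22 u02 d21 d22 d01 d02) (Nat.add (cellB t01 t02 t00 t21 t22 t20 u12
    u22 u02 u10 u20 u00 d22 d20 d02 d00) (Nat.add (cellB t02 t00 t01 t22 t20 t21 u10 u20 u00 u11
    u21 u01 d20 d21 d00 d01) (Nat.add (cellB t10 t11 t12 t00 t01 t02 u21 u01 u11 u22 u02 u12 d01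
    d02 d11 d12) (Nat.add (cellB t11 t12 t10 t01 t02 t00 u22 u02 u12 u20 u00 u10 d02 d00 d12 d10)
    ((cellB t12 t10 t11 t02 t00 t01 u20 u00 u10 u21 u01 u11 d00 d01 d10 d11))))))))))

theorem chkT_0 : chkT false false false false false false false false false = true := by decide +kernel
theorem chkT_1 : chkT false false false false false false false false true = true := by decide +kernel
theorem chkT_2 : chkT false false false false false false false true true = true := by decide +kernel
theorem chkT_3 : chkT false false false false false false true true true = true := by decide +kernel
theorem chkT_4 : chkT false false false false false true false false true = true := by decide +kernel
theorem chkT_5 : chkT false false false false false true false true false = true := by decide +kernel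
theorem chkT_6 : chkT false false false false false true false true true = true := by decide +kernel
theorem chkT_7 : chkT false false false false false true true false false = true := by decide +kernel
theorem chkT_8 : chkT false false false false false true true false true = true := by decide +kernel
theorem chkT_9 : chkT false false false false false true true true false = true := by decide +kernel
theorem chkT_10 : chkT false false false false false true true true true = true := by decide +kernel
theorem chkT_11 : chkT false false false false true true false false true = true := by decide +kernel
theorem chkT_12 : chkT false false false false true true false true false = true := by decide +kernel
theorem chkT_13 : chkT false false false false true true false true true = true := by decide +kernel
theorem chkT_14 : chkT false false false false true true true false false = true := by decide +kernel
theorem chkT_15 : chkT false false false false true true true false true = true := by decide +kernel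
theorem chkT_16 : chkT false false false false true true true true false = true := by decide +kernel
theorem chkT_17 : chkT false false false false true true true true true = true := by decide +kernel
theorem chkT_18 : chkT false false true false false true false false true = true := by decide +kernel
theorem chkT_19 : chkT false false true false false true false true false = true := by decide +kernel
theorem chkT_20 : chkT false false true false false true false true true = true := by decide +kernel
theorem chkT_21 : chkT false false true false false true true false false = true := by decide +kernel
theorem chkT_22 : chkT false false true false false true true false true = true := by decide +kernel
theorem chkT_23 : chkT false false true false false true true true false = true := by decide +kernel
theorem chkT_24 : chkT false false true false true false false true true = true := by decide +kernel
theorem chkT_25 : chkT false false true false true false true false false = true := by decide +kernel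
theorem chkT_26 : chkT false false true false true false true false true = true := by decide +kernel
theorem chkT_27 : chkT false false true false true false true true false = true := by decide +kernel
theorem chkT_28 : chkT false false true false true true false true false = true := by decide +kernel
theorem chkT_29 : chkT false false true true false false false true false = true := by decide +kernel
theorem chkT_30 : chkT false false true true false false false true true = true := by decide +kernel
theorem chkT_31 : chkT false false true true false false true true false = true := by decide +kernel

/-- the check on tuples -/
def chkR (r : B9) : Bool :=
  chkT r.1 r.2.1 r.2.2.1 r.2.2.2.1 r.2.2.2.2.1 r.2.2.2.2.2.1 r.2.2.2.2.2.2.1 r.2.2.2.2.2.2.2.1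
    r.2.2.2.2.2.2.2.2

theorem chkR_reps : ∀ r ∈ repsL, chkR r = true := by
  unfold repsL
  simp only [List.forall_mem_cons]
  exact ⟨chkT_0, chkT_1, chkT_2, chkT_3, chkT_4, chkT_5, chkT_6, chkT_7, chkT_8, chkT_9, chkT_10,
    chkT_11, chkT_12, chkT_13, chkT_14, chkT_15, chkT_16, chkT_17, chkT_18, chkT_19,
    chkT_20, chkT_21, chkT_22, chkT_23, chkT_24, chkT_25, chkT_26, chkT_27, chkT_28,
    chkT_29, chkT_30, chkT_31,
    fun _ h => absurd h List.not_mem_nil⟩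

theorem chkT_of_isRep (a b c d e f g h i : Bool) (H : isRep a b c d e f g h i = true) :
    chkT a b c d e f g h i = true := by
  obtain ⟨r, hr, e⟩ := List.any_eq_true.1 H
  have := chkR_reps r hr
  rw [eq9_spec _ _ _ _ _ _ _ _ _ _ e] at this
  exact this

/-- every pattern is equivalent to a representative -/
def repCheck : Bool :=
  allB fun t00 =>
  allB fun t01 =>
  allB fun t02 =>
  allB fun t10 =>
  allB fun t11 =>
  allB fun t12 =>
  allB fun t20 =>
  allB fun t21 =>
  allB fun t22 =>
  (isRep t00 t01 t02 t10 t11 t12 t20 t21 t22 ||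
    isRep t01 t02 t00 t11 t12 t10 t21 t22 t20 ||
    isRep t02 t00 t01 t12 t10 t11 t22 t20 t21 ||
    isRep t10 t11 t12 t20 t21 t22 t00 t01 t02 ||
    isRep t11 t12 t10 t21 t22 t20 t01 t02 t00 ||
    isRep t12 t10 t11 t22 t20 t21 t02 t00 t01 ||
    isRep t20 t21 t22 t00 t01 t02 t10 t11 t12 ||
    isRep t21 t22 t20 t01 t02 t00 t11 t12 t10 ||
    isRep t22 t20 t21 t02 t00 t01 t12 t10 t11 ||
    isRep (!t00) (!t01) (!t02) (!t10) (!t11) (!t12) (!t20) (!t21) (!t22) ||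
    isRep (!t01) (!t02) (!t00) (!t11) (!t12) (!t10) (!t21) (!t22) (!t20) ||
    isRep (!t02) (!t00) (!t01) (!t12) (!t10) (!t11) (!t22) (!t20) (!t21) ||
    isRep (!t10) (!t11) (!t12) (!t20) (!t21) (!t22) (!t00) (!t01) (!t02) ||
    isRep (!t11) (!t12) (!t10) (!t21) (!t22) (!t20) (!t01) (!t02) (!t00) ||
    isRep (!t12) (!t10) (!t11) (!t22) (!t20) (!t21) (!t02) (!t00) (!t01) ||
    isRep (!t20) (!t21) (!t22) (!t00) (!t01) (!t02) (!t10) (!t11) (!t12) ||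
    isRep (!t21) (!t22) (!t20) (!t01) (!t02) (!t00) (!t11) (!t12) (!t10) ||
    isRep (!t22) (!t20) (!t21) (!t02) (!t00) (!t01) (!t12) (!t10) (!t11))

theorem repCheck_true : repCheck = true := by decide +kernel

/-- sign matrices -/
abbrev SM := Fin 3 → Fin 3 → Bool

/-- the constraints on the sign matrices -/
structure Valid (T U D : SM) : Prop where
  r : ∀ i k, i ≠ k → nae3 (xor (T i 0) (U k 0)) (xor (T i 1) (U k 1)) (xor (T i 2) (U k 2)) = true
  c : ∀ j k, j ≠ k → nae3 (xor (T 0 j) (U 0 k)) (xor (T 1 j) (U 1 k)) (xor (T 2 j) (U 2 k)) = true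
  td : ∀ i, nae3 (xor (T i 0) (D i 0)) (xor (T i 1) (D i 1)) (xor (T i 2) (D i 2)) = true
  ud : ∀ j, nae3 (xor (U 0 j) (D 0 j)) (xor (U 1 j) (D 1 j)) (xor (U 2 j) (D 2 j)) = true
  aff : ∀ i j, nae5 (D i j) (T i (j+1)) (!T i (j+2)) (U (i+1) j) (!U (i+2) j) = true

/-- is the cell linked -/
def cellF (T U D : SM) (i j : Fin 3) : ℕ :=
  cellB (T (i+2) j) (T (i+2) (j+1)) (T (i+2) (j+2)) (T (i+1) j) (T (i+1) (j+1)) (T (i+1) (j+2))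
    (U i (j+1)) (U (i+1) (j+1)) (U (i+2) (j+1)) (U i (j+2)) (U (i+1) (j+2)) (U (i+2) (j+2))
    (D (i+1) (j+1)) (D (i+1) (j+2)) (D (i+2) (j+1)) (D (i+2) (j+2))

/-- number of linked cells -/
def total (T U D : SM) : ℕ := ∑ p : Fin 3 × Fin 3, cellF T U D p.1 p.2

/-- representative flag -/
def repF (T : SM) : Bool :=
  isRep (T 0 0) (T 0 1) (T 0 2) (T 1 0) (T 1 1) (T 1 2) (T 2 0) (T 2 1) (T 2 2)

/-- shifted and negated matrix -/
def shf (r s : Fin 3) (n : Bool) (T : SM) : SM := fun i j => xor n (T (i + r) (j + s))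

lemma total_rep {T U D : SM} (h : Valid T U D) (hr : repF T = true) :
    1 ≤ total T U D ∧ total T U D ≤ 5 := by
  have H := chkT_of_isRep _ _ _ _ _ _ _ _ _ hr
  unfold chkT at H
  simp only [allB_iff, imp_iff] at H
  have K := H (U 0 0) (U 0 1) (U 0 2) (h.r 1 0 (by decide)) (h.r 2 0 (by decide))
    (U 1 0) (U 1 1) (U 1 2) (h.r 0 1 (by decide)) (h.r 2 1 (by decide))
    (U 2 0) (U 2 1) (U 2 2) (h.r 0 2 (by decide)) (h.r 1 2 (by decide))
    (h.c 1 0 (by decide)) (h.c 2 0 (by decide)) (h.c 0 1 (by decide)) (h.c 2 1 (by decide))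
    (h.c 0 2 (by decide)) (h.c 1 2 (by decide))
    (D 0 0) (h.aff 0 0) (D 0 1) (h.aff 0 1) (D 0 2) (h.aff 0 2) (h.td 0)
    (D 1 0) (h.aff 1 0) (D 1 1) (h.aff 1 1) (D 1 2) (h.aff 1 2) (h.td 1)
    (D 2 0) (h.aff 2 0) (D 2 1) (h.aff 2 1) (D 2 2) (h.aff 2 2) (h.td 2)
    (h.ud 0) (h.ud 1) (h.ud 2)
  have e : total T U D = cellF T U D 0 0 + (cellF T U D 0 1 + (cellF T U D 0 2 +
      (cellF T U D 1 0 + (cellF T U D 1 1 + (cellF T U D 1 2 +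
      (cellF T U D 2 0 + (cellF T U D 2 1 + cellF T U D 2 2))))))) := by
    rw [total, Fintype.sum_prod_type]
    simp only [Fin.sum_univ_three]
    ring
  have K' : inR (total T U D) = true := by
    rw [e]; exact K
  unfold inR at K'
  rw [Bool.and_eq_true] at K'
  exact ⟨Nat.le_of_ble_eq_true K'.1, Nat.le_of_ble_eq_true K'.2⟩

lemma nae3_rot (a b c : Bool) : nae3 b c a = nae3 a b c := by
  cases a <;> cases b <;> cases c <;> rfl
lemma xor_neg2 (n a b : Bool) : xor (xor n a) (xor n b) = xor a b := by
  cases a <;> cases b <;> cases n <;> rfl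
lemma nae3_rotF (f : Fin 3 → Bool) (s : Fin 3) :
    nae3 (f (0 + s)) (f (1 + s)) (f (2 + s)) = nae3 (f 0) (f 1) (f 2) := by
  fin_cases s
  · rfl
  · exact nae3_rot _ _ _
  · exact (nae3_rot _ _ _).trans (nae3_rot _ _ _)

lemma nae5_neg (n a b c d e : Bool) : nae5 (xor n a) (xor n b) (!xor n c) (xor n d) (!xor n e) =
    nae5 a b (!c) d (!e) := by
  cases n <;> cases a <;> cases b <;> cases c <;> cases d <;> cases e <;> rfl

lemma Valid.shf {T U D : SM} (h : Valid T U D) (r s : Fin 3) (n : Bool) :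
    Valid (shf r s n T) (shf r s n U) (shf r s n D) where
  r i k hik := by
    simp only [_root_.shf, xor_neg2]
    rw [nae3_rotF (fun j => xor (T (i + r) j) (U (k + r) j))]
    exact h.r _ _ (by simpa using hik)
  c i k hik := by
    simp only [_root_.shf, xor_neg2]
    rw [nae3_rotF (fun j => xor (T j (i + s)) (U j (k + s)))]
    exact h.c _ _ (by simpa using hik)
  td i := by
    simp only [_root_.shf, xor_neg2]
    rw [nae3_rotF (fun j => xor (T (i + r) j) (D (i + r) j))]
    exact h.td _
  ud i := by
    simp only [_root_.shf, xor_neg2]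
    rw [nae3_rotF (fun j => xor (U j (i + s)) (D j (i + s)))]
    exact h.ud _
  aff i j := by
    simp only [_root_.shf, nae5_neg]
    have := h.aff (i + r) (j + s)
    simpa only [add_right_comm] using this

lemma ev_neg (p q u v w : Bool) : ev (!p) (!q) (!u) (!v) (!w) + ev p q u v w = 2 := by
  cases p <;> cases q <;> cases u <;> cases v <;> cases w <;> rfl

lemma cellN_neg (a1 a2 a3 a4 a5 a6 a7 a8 a9 b1 b2 b3 b4 b5 b6 b7 : Bool) :
    cellN (!a1) (!a2) (!a3) (!a4) (!a5) (!a6) (!a7) (!a8) (!a9) (!b1) (!b2) (!b3) (!b4) (!b5)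
      (!b6) (!b7) + cellN a1 a2 a3 a4 a5 a6 a7 a8 a9 b1 b2 b3 b4 b5 b6 b7 = 8 := by
  unfold cellN
  have h1 := ev_neg (!a1) b1 a2 (!b7) b2
  have h2 := ev_neg b1 a4 (!a5) b5 b3
  have h3 := ev_neg a4 (!a7) (!a6) (!b4) (!a9)
  have h4 := ev_neg (!a7) (!a1) a3 b6 (!a8)
  simp only [Nat.add_eq] at *
  omega

lemma cellB_neg (n a1 a2 a3 a4 a5 a6 a7 a8 a9 b1 b2 b3 b4 b5 b6 b7 : Bool) :
    cellB (xor n a1) (xor n a2) (xor n a3) (xor n a4) (xor n a5) (xor n a6) (xor n a7) (xor n a8)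
      (xor n a9) (xor n b1) (xor n b2) (xor n b3) (xor n b4) (xor n b5)
      (xor n b6) (xor n b7) = cellB a1 a2 a3 a4 a5 a6 a7 a8 a9 b1 b2 b3 b4 b5 b6 b7 := by
  cases n
  · simp
  · simp only [Bool.true_xor]
    have := cellN_neg a1 a2 a3 a4 a5 a6 a7 a8 a9 b1 b2 b3 b4 b5 b6 b7
    unfold cellB
    congr 1
    rw [Bool.eq_iff_iff, Nat.beq_eq, Nat.beq_eq]
    omega

lemma cellF_shf (T U D : SM) (r s : Fin 3) (n : Bool) (i j : Fin 3) :
    cellF (shf r s n T) (shf r s n U) (shf r s n D) i j = cellF T U D (i + r) (j + s) := by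
  unfold cellF shf
  rw [cellB_neg]
  simp only [add_right_comm]

lemma total_shf (T U D : SM) (r s : Fin 3) (n : Bool) :
    total (shf r s n T) (shf r s n U) (shf r s n D) = total T U D := by
  unfold total
  simp only [cellF_shf]
  exact Equiv.sum_comp ((Equiv.addRight r).prodCongr (Equiv.addRight s))
    (fun p : Fin 3 × Fin 3 => cellF T U D p.1 p.2)

lemma exists_rep (T : SM) : ∃ r s n, repF (shf r s n T) = true := by
  have H := repCheck_true
  unfold repCheck at H
  simp only [allB_iff] at H
  have K := H (T 0 0) (T 0 1) (T 0 2) (T 1 0) (T 1 1) (T 1 2) (T 2 0) (T 2 1) (T 2 2)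
  have e : ∀ r s, repF (fun i j => T (i + r) (j + s)) = repF (shf r s false T) := by
    intro r s
    congr 1
    funext i j
    simp [shf]
  simp only [Bool.or_eq_true, or_assoc] at K
  rcases K with h|h|h|h|h|h|h|h|h|h|h|h|h|h|h|h|h|h
  · exact ⟨0, 0, false, (e 0 0) ▸ h⟩
  · exact ⟨0, 1, false, (e 0 1) ▸ h⟩
  · exact ⟨0, 2, false, (e 0 2) ▸ h⟩
  · exact ⟨1, 0, false, (e 1 0) ▸ h⟩
  · exact ⟨1, 1, false, (e 1 1) ▸ h⟩
  · exact ⟨1, 2, false, (e 1 2) ▸ h⟩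
  · exact ⟨2, 0, false, (e 2 0) ▸ h⟩
  · exact ⟨2, 1, false, (e 2 1) ▸ h⟩
  · exact ⟨2, 2, false, (e 2 2) ▸ h⟩
  · exact ⟨0, 0, true, by simpa [shf, repF] using h⟩
  · exact ⟨0, 1, true, by simpa [shf, repF] using h⟩
  · exact ⟨0, 2, true, by simpa [shf, repF] using h⟩
  · exact ⟨1, 0, true, by simpa [shf, repF] using h⟩
  · exact ⟨1, 1, true, by simpa [shf, repF] using h⟩
  · exact ⟨1, 2, true, by simpa [shf, repF] using h⟩
  · exact ⟨2, 0, true, by simpa [shf, repF] using h⟩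
  · exact ⟨2, 1, true, by simpa [shf, repF] using h⟩
  · exact ⟨2, 2, true, by simpa [shf, repF] using h⟩

theorem total_bounds {T U D : SM} (h : Valid T U D) : 1 ≤ total T U D ∧ total T U D ≤ 5 := by
  obtain ⟨r, s, n, hr⟩ := exists_rep T
  rw [← total_shf T U D r s n]
  exact total_rep (h.shf r s n) hr

lemma sb_mul {x y : ℝ} (hx : x ≠ 0) (hy : y ≠ 0) : sb (x * y) = !(xor (sb x) (sb y)) := by
  unfold sb
  rcases lt_or_gt_of_ne hx with h | h <;> rcases lt_or_gt_of_ne hy with k | k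
  · simp [mul_pos_of_neg_of_neg h k, not_lt.2 h.le, not_lt.2 k.le]
  · simp [not_lt.2 (mul_neg_of_neg_of_pos h k).le, not_lt.2 h.le, k]
  · simp [not_lt.2 (mul_neg_of_pos_of_neg h k).le, not_lt.2 k.le, h]
  · simp [mul_pos h k, h, k]

lemma nae3_sum {x y z : ℝ} (hx : x ≠ 0) (h : x + y + z = 0) :
    nae3 (sb x) (sb y) (sb z) = true := by
  unfold sb nae3
  by_cases h1 : 0 < x <;> by_cases h2 : 0 < y <;> by_cases h3 : 0 < z <;> simp [h1, h2, h3]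
  · linarith
  · have := lt_of_le_of_ne (not_lt.1 h1) hx
    linarith

lemma nae3_not (a b c : Bool) : nae3 (!a) (!b) (!c) = nae3 a b c := by
  cases a <;> cases b <;> cases c <;> rfl

lemma nae3_prod {x y z x' y' z' : ℝ} (hx : x ≠ 0) (hy : y ≠ 0) (hz : z ≠ 0)
    (hx' : x' ≠ 0) (hy' : y' ≠ 0) (hz' : z' ≠ 0) (h : x * x' + y * y' + z * z' = 0) :
    nae3 (xor (sb x) (sb x')) (xor (sb y) (sb y')) (xor (sb z) (sb z')) = true := by
  have := nae3_sum (mul_ne_zero hx hx') h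
  rw [sb_mul hx hx', sb_mul hy hy', sb_mul hz hz', nae3_not] at this
  exact this

lemma nae5_sum {x y z u w : ℝ} (hx : x ≠ 0) (h : x + y + z + u + w = 0)  :
    nae5 (sb x) (sb y) (sb z) (sb u) (sb w) = true := by
  unfold sb nae5
  by_cases h1 : 0 < x <;> by_cases h2 : 0 < y <;> by_cases h3 : 0 < z <;> by_cases h4 : 0 < u <;>
    by_cases h5 : 0 < w <;> simp [h1, h2, h3, h4, h5]
  · linarith
  · have := lt_of_le_of_ne (not_lt.1 h1) hx
    linarith

/-- determinants with two odd vertices -/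
def Td (v : Fin 7 → E3) (i j : Fin 3) : ℝ :=
  o4 (v 6) (v (odds (i+1))) (v (odds (i+2))) (v (evens j))
/-- determinants with two even vertices -/
def Ud (v : Fin 7 → E3) (i j : Fin 3) : ℝ :=
  o4 (v 6) (v (odds i)) (v (evens (j+1))) (v (evens (j+2)))
/-- determinants without the cone vertex -/
def Dd (v : Fin 7 → E3) (i j : Fin 3) : ℝ :=
  o4 (v (odds (i+1))) (v (odds (i+2))) (v (evens (j+1))) (v (evens (j+2)))

lemma o4_rel1 (z a b p q r : E3) : o4 z a b p * o4 z a q r + o4 z a b q * o4 z a r p +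
    o4 z a b r * o4 z a p q = 0 := by
  simp only [o4, det3, PiLp.sub_apply]; ring
lemma o4_rel1' (z a b p q r : E3) : o4 z b a p * o4 z a q r + o4 z b a q * o4 z a r p +
    o4 z b a r * o4 z a p q = 0 := by
  simp only [o4, det3, PiLp.sub_apply]; ring
lemma o4_rel2 (z a b c p q : E3) : o4 z b c p * o4 z a p q + o4 z c a p * o4 z b p q +
    o4 z a b p * o4 z c p q = 0 := by
  simp only [o4, det3, PiLp.sub_apply]; ring
lemma o4_rel2' (z a b c p q : E3) : o4 z b c p * o4 z a q p + o4 z c a p * o4 z b q p +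
    o4 z a b p * o4 z c q p = 0 := by
  simp only [o4, det3, PiLp.sub_apply]; ring
lemma o4_rel3 (z a b p q : E3) : o4 a b p q + o4 z a b p + - o4 z a b q + o4 z a p q
    + - o4 z b p q = 0 := by
  simp only [o4, det3, PiLp.sub_apply]; ring
lemma o4_rel4 (z a b p q r : E3) : o4 z a b p * o4 a b q r + o4 z a b q * o4 a b r p +
    o4 z a b r * o4 a b p q = 0 := by
  simp only [o4, det3, PiLp.sub_apply]; ring
lemma o4_rel5 (z a b c p q : E3) : o4 z a p q * o4 b c p q + o4 z b p q * o4 c a p q +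
    o4 z c p q * o4 a b p q = 0 := by
  simp only [o4, det3, PiLp.sub_apply]; ring

lemma gp_o4 {v : Fin 7 → E3} (hv : GenPos7 v) (i j k l : Fin 7) (h1 : i ≠ j) (h2 : i ≠ k) (h3 : i ≠ l)
    (h4 : j ≠ k) (h5 : j ≠ l) (h6 : k ≠ l) : o4 (v i) (v j) (v k) (v l) ≠ 0 :=
  (affInd_iff_o4 _ _ _ _).1 (hv i j k l h1 h2 h3 h4 h5 h6)

lemma six_ne_odds (i : Fin 3) : (6 : Fin 7) ≠ odds i := by revert i; decide
lemma six_ne_evens (i : Fin 3) : (6 : Fin 7) ≠ evens i := by revert i; decide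
lemma odds_ne_evens (i j : Fin 3) : odds i ≠ evens j := by revert i j; decide
lemma odds_ne (i j : Fin 3) (h : i ≠ j) : odds i ≠ odds j := by revert i j; decide
lemma evens_ne (i j : Fin 3) (h : i ≠ j) : evens i ≠ evens j := by revert i j; decide
lemma fin3_12 (i : Fin 3) : i + 1 ≠ i + 2 := by revert i; decide

lemma fin3_cases (i k : Fin 3) (h : i ≠ k) : k = i + 1 ∨ k = i + 2 := by revert i k; decide

lemma Td_ne {v : Fin 7 → E3} (hv : GenPos7 v) (i j : Fin 3) : Td v i j ≠ 0 :=
  gp_o4 hv _ _ _ _ (six_ne_odds _) (six_ne_odds _) (six_ne_evens _) (odds_ne _ _ (fin3_12 i))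
    (odds_ne_evens _ _) (odds_ne_evens _ _)
lemma Ud_ne {v : Fin 7 → E3} (hv : GenPos7 v) (i j : Fin 3) : Ud v i j ≠ 0 :=
  gp_o4 hv _ _ _ _ (six_ne_odds _) (six_ne_evens _) (six_ne_evens _)
    (odds_ne_evens _ _) (odds_ne_evens _ _) (evens_ne _ _ (fin3_12 j))
lemma Dd_ne {v : Fin 7 → E3} (hv : GenPos7 v) (i j : Fin 3) : Dd v i j ≠ 0 :=
  gp_o4 hv _ _ _ _ (odds_ne _ _ (fin3_12 i)) (odds_ne_evens _ _) (odds_ne_evens _ _)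
    (odds_ne_evens _ _) (odds_ne_evens _ _) (evens_ne _ _ (fin3_12 j))

/-- sign bit matrix -/
def sm (M : Fin 3 → Fin 3 → ℝ) : SM := fun i j => sb (M i j)

lemma valid_geom {v : Fin 7 → E3} (hv : GenPos7 v) : Valid (sm (Td v)) (sm (Ud v)) (sm (Dd v)) where
  r i k hik := by
    apply nae3_prod (Td_ne hv _ _) (Td_ne hv _ _) (Td_ne hv _ _) (Ud_ne hv _ _) (Ud_ne hv _ _)
      (Ud_ne hv _ _)
    rcases fin3_cases i k hik with rfl | rfl
    · exact o4_rel1 (v 6) (v (odds (i+1))) (v (odds (i+2))) (v (evens 0)) (v (evens 1)) (v (evens 2))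
    · exact o4_rel1' (v 6) (v (odds (i+2))) (v (odds (i+1))) (v (evens 0)) (v (evens 1)) (v (evens 2))
  c i k hik := by
    apply nae3_prod (Td_ne hv _ _) (Td_ne hv _ _) (Td_ne hv _ _) (Ud_ne hv _ _) (Ud_ne hv _ _)
      (Ud_ne hv _ _)
    rcases fin3_cases k i hik.symm with rfl | rfl
    · exact o4_rel2 (v 6) (v (odds 0)) (v (odds 1)) (v (odds 2)) (v (evens (k+1))) (v (evens (k+2)))
    · exact o4_rel2' (v 6) (v (odds 0)) (v (odds 1)) (v (odds 2)) (v (evens (k+2))) (v (evens (k+1)))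
  td i := by
    apply nae3_prod (Td_ne hv _ _) (Td_ne hv _ _) (Td_ne hv _ _) (Dd_ne hv _ _) (Dd_ne hv _ _)
      (Dd_ne hv _ _)
    exact o4_rel4 _ _ _ _ _ _
  ud i := by
    apply nae3_prod (Ud_ne hv _ _) (Ud_ne hv _ _) (Ud_ne hv _ _) (Dd_ne hv _ _) (Dd_ne hv _ _)
      (Dd_ne hv _ _)
    exact o4_rel5 _ _ _ _ _ _
  aff i j := by
    unfold sm
    rw [← sb_neg (Td_ne hv _ _), ← sb_neg (Ud_ne hv _ _)]
    exact nae5_sum (Dd_ne hv _ _) (o4_rel3 _ _ _ _ _)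

lemma ev_tri (p q u v w : Bool) : ev p q (!u) (!v) (!w) = ev p q u v w := by
  cases p <;> cases q <;> cases u <;> cases v <;> cases w <;> rfl

/-- The linking number in terms of sign bits. -/
lemma lk_cell (z a b a1 b1 a2 b2 : E3)
    (T20 : o4 z a a1 b ≠ 0) (T21 : o4 z a a1 b1 ≠ 0) (T22 : o4 z a a1 b2 ≠ 0)
    (T10 : o4 z a2 a b ≠ 0) (T11 : o4 z a2 a b1 ≠ 0) (T12 : o4 z a2 a b2 ≠ 0)
    (U01 : o4 z a b2 b ≠ 0) (U11 : o4 z a1 b2 b ≠ 0) (U21 : o4 z a2 b2 b ≠ 0)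
    (U02 : o4 z a b b1 ≠ 0) (U12 : o4 z a1 b b1 ≠ 0) (U22 : o4 z a2 b b1 ≠ 0)
    (D11 : o4 a2 a b2 b ≠ 0) (D12 : o4 a2 a b b1 ≠ 0) (D21 : o4 a a1 b2 b ≠ 0)
    (D22 : o4 a a1 b b1 ≠ 0) :
    lkTriQuad z a b a1 b1 a2 b2 = (cellN (sb (o4 z a a1 b)) (sb (o4 z a a1 b1)) (sb (o4 z a a1 b2))
      (sb (o4 z a2 a b)) (sb (o4 z a2 a b1)) (sb (o4 z a2 a b2))
      (sb (o4 z a b2 b)) (sb (o4 z a1 b2 b)) (sb (o4 z a2 b2 b))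
      (sb (o4 z a b b1)) (sb (o4 z a1 b b1)) (sb (o4 z a2 b b1))
      (sb (o4 a2 a b2 b)) (sb (o4 a2 a b b1)) (sb (o4 a a1 b2 b)) (sb (o4 a a1 b b1)) : ℤ) - 4 := by
  have x1 : o4 z a b a1 = - o4 z a a1 b := by simp only [o4, det3, PiLp.sub_apply]; ring
  have x2 : o4 z a b a2 = o4 z a2 a b := by simp only [o4, det3, PiLp.sub_apply]; ring
  have x3 : o4 z a b b2 = - o4 z a b2 b := by simp only [o4, det3, PiLp.sub_apply]; ring
  have e11 : o4 a1 b1 z a = o4 z a a1 b1 := by simp only [o4, det3, PiLp.sub_apply]; ring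
  have e12 : o4 a1 b1 a b = - o4 a a1 b b1 := by simp only [o4, det3, PiLp.sub_apply]; ring
  have e13 : o4 a1 b1 b z = o4 z a1 b b1 := by simp only [o4, det3, PiLp.sub_apply]; ring
  have e21 : o4 b1 a2 z a = - - o4 z a2 a b1 := by simp only [o4, det3, PiLp.sub_apply]; ring
  have e22 : o4 b1 a2 a b = - o4 a2 a b b1 := by simp only [o4, det3, PiLp.sub_apply]; ring
  have e23 : o4 b1 a2 b z = - o4 z a2 b b1 := by simp only [o4, det3, PiLp.sub_apply]; ring
  have e31 : o4 a2 b2 z a = - o4 z a2 a b2 := by simp only [o4, det3, PiLp.sub_apply]; ring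
  have e32 : o4 a2 b2 a b = - o4 a2 a b2 b := by simp only [o4, det3, PiLp.sub_apply]; ring
  have e33 : o4 a2 b2 b z = - o4 z a2 b2 b := by simp only [o4, det3, PiLp.sub_apply]; ring
  have e41 : o4 b2 a1 z a = - o4 z a a1 b2 := by simp only [o4, det3, PiLp.sub_apply]; ring
  have e42 : o4 b2 a1 a b = - o4 a a1 b2 b := by simp only [o4, det3, PiLp.sub_apply]; ring
  have e43 : o4 b2 a1 b z = - - o4 z a1 b2 b := by simp only [o4, det3, PiLp.sub_apply]; ring
  have n := fun {x : ℝ} (h : x ≠ 0) => neg_ne_zero.2 h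
  unfold lkTriQuad
  rw [edgeSign_eq (x1 ▸ n T20) U02 (e12 ▸ n D22) (e13 ▸ U12) (e11 ▸ T21),
    edgeSign_eq U02 (x2 ▸ T10) (e22 ▸ n D12) (e23 ▸ n U22) (e21 ▸ n (n T11)),
    edgeSign_eq (x2 ▸ T10) (x3 ▸ n U01) (e32 ▸ n D11) (e33 ▸ n U21) (e31 ▸ n T12),
    edgeSign_eq (x3 ▸ n U01) (x1 ▸ n T20) (e42 ▸ n D21) (e43 ▸ n (n U11)) (e41 ▸ n T22)]
  rw [x1, x2, x3, e11, e12, e13, e21, e22, e23, e31, e32, e33, e41, e42, e43]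
  rw [sb_neg (n T11), sb_neg (n U11)]
  rw [sb_neg T20, sb_neg U01, sb_neg D22, sb_neg T11, sb_neg D12, sb_neg U22, sb_neg T12, sb_neg D11,
    sb_neg U21, sb_neg T22, sb_neg D21, sb_neg U11]
  rw [ev_tri (sb (o4 z a b b1)), ev_tri (!sb (o4 z a b2 b)) (!sb (o4 z a a1 b))]
  unfold cellN
  simp only [Nat.add_eq]
  push_cast
  ring

lemma lk_eq {v : Fin 7 → E3} (hv : GenPos7 v) (i j : Fin 3) :
    (if lk331 v i j ≠ 0 then 1 else 0) = cellF (sm (Td v)) (sm (Ud v)) (sm (Dd v)) i j := by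
  have A : (i + 2) + 1 = i ∧ (i + 2) + 2 = i + 1 ∧ (i + 1) + 1 = i + 2 ∧ (i + 1) + 2 = i := by
    revert i; decide
  have B : (j + 2) + 1 = j ∧ (j + 2) + 2 = j + 1 ∧ (j + 1) + 1 = j + 2 ∧ (j + 1) + 2 = j := by
    revert j; decide
  obtain ⟨A1, A2, A3, A4⟩ := A
  obtain ⟨B1, B2, B3, B4⟩ := B
  have hT := Td_ne hv
  have hU := Ud_ne hv
  have hD := Dd_ne hv
  have t2 := hT (i + 2)
  have t1 := hT (i + 1)
  have u1 := fun k => hU k (j + 1)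
  have u2 := fun k => hU k (j + 2)
  have d11 := hD (i + 1) (j + 1)
  have d12 := hD (i + 1) (j + 2)
  have d21 := hD (i + 2) (j + 1)
  have d22 := hD (i + 2) (j + 2)
  simp only [Td, Ud, Dd, A1, A2, A3, A4, B1, B2, B3, B4] at t1 t2 u1 u2 d11 d12 d21 d22
  have := lk_cell (v 6) (v (odds i)) (v (evens j)) (v (odds (i+1))) (v (evens (j+1)))
    (v (odds (i+2))) (v (evens (j+2))) (t2 j) (t2 (j+1)) (t2 (j+2)) (t1 j) (t1 (j+1)) (t1 (j+2))
    (u1 i) (u1 (i+1)) (u1 (i+2)) (u2 i) (u2 (i+1)) (u2 (i+2)) d11 d12 d21 d22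
  unfold lk331 cellF cellB sm
  rw [this]
  simp only [Td, Ud, Dd, A1, A2, A3, A4, B1, B2, B3, B4]
  generalize cellN _ _ _ _ _ _ _ _ _ _ _ _ _ _ _ _ = N
  by_cases h : N = 4
  · subst h; simp
  · have h1 : Nat.beq N 4 = false := by
      rw [Bool.eq_false_iff]; intro h'; exact h (Nat.eq_of_beq_eq_true h')
    have h2 : (N : ℤ) - 4 ≠ 0 := by omega
    simp [h1, h2]

theorem lk_count {v : Fin 7 → E3} (hv : GenPos7 v) :
    (Finset.univ.filter fun p : Fin 3 × Fin 3 => lk331 v p.1 p.2 ≠ 0).card =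
      total (sm (Td v)) (sm (Ud v)) (sm (Dd v)) := by
  rw [Finset.card_filter]
  unfold total
  refine Finset.sum_congr rfl fun p _ => ?_
  rw [← lk_eq hv]

/-- scalar part of the Van Oosterom–Strackee function -/
def vosN (a b c : E3) : ℝ :=
  ‖a‖ * ‖b‖ * ‖c‖ + inner ℝ a b * ‖c‖ + inner ℝ b c * ‖a‖ + inner ℝ c a * ‖b‖

lemma inner3 (a b : E3) : inner ℝ a b = a 0 * b 0 + a 1 * b 1 + a 2 * b 2 := by
  simp [PiLp.inner_apply, Fin.sum_univ_three]; ring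

lemma normsq3 (a : E3) : ‖a‖ ^ 2 = a 0 * a 0 + a 1 * a 1 + a 2 * a 2 := by
  rw [← inner3, real_inner_self_eq_norm_sq]

lemma det3_sq (a b c : E3) : det3 a b c ^ 2 = ‖a‖ ^ 2 * ‖b‖ ^ 2 * ‖c‖ ^ 2 +
    2 * inner ℝ a b * inner ℝ b c * inner ℝ c a - ‖a‖ ^ 2 * (inner ℝ b c) ^ 2
    - ‖b‖ ^ 2 * (inner ℝ c a) ^ 2 - ‖c‖ ^ 2 * (inner ℝ a b) ^ 2 := by
  simp only [normsq3, inner3, det3]; ring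

lemma vos_sq (a b c : E3) : vosN a b c ^ 2 + det3 a b c ^ 2 =
    2 * (‖a‖ * ‖b‖ + inner ℝ a b) * (‖b‖ * ‖c‖ + inner ℝ b c) * (‖c‖ * ‖a‖ + inner ℝ c a) := by
  rw [det3_sq, vosN]; ring

lemma mem_segment_of_inner {A B x : E3} (h : ‖A - x‖ * ‖B - x‖ + inner ℝ (A - x) (B - x) = 0) :
    x ∈ segment ℝ A B := by
  rw [mem_segment_iff_sameRay, sameRay_iff_norm_smul_eq, eq_comm, ← inner_eq_norm_mul_iff_real]
  rw [← neg_sub A x, inner_neg_left, norm_neg]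
  linarith

/-- the Van Oosterom–Strackee function of a triangle -/
def vosZ (A B C x : E3) : ℂ := ⟨vosN (A - x) (B - x) (C - x), det3 (A - x) (B - x) (C - x)⟩

lemma vosZ_ne {A B C x : E3} (hx : x ∉ cycle3 A B C) : vosZ A B C x ≠ 0 := by
  intro h
  apply hx
  have h1 : vosN (A - x) (B - x) (C - x) = 0 := congrArg Complex.re h
  have h2 : det3 (A - x) (B - x) (C - x) = 0 := congrArg Complex.im h
  have h3 := vos_sq (A - x) (B - x) (C - x)
  rw [h1, h2] at h3
  have h4 : (‖A - x‖ * ‖B - x‖ + inner ℝ (A - x) (B - x)) * (‖B - x‖ * ‖C - x‖ + inner ℝ (B - x) (C - x))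
    * (‖C - x‖ * ‖A - x‖ + inner ℝ (C - x) (A - x)) = 0 := by linarith
  rcases mul_eq_zero.1 h4 with h5 | h5
  · rcases mul_eq_zero.1 h5 with h6 | h6
    · exact Or.inl (Or.inl (mem_segment_of_inner h6))
    · exact Or.inl (Or.inr (mem_segment_of_inner h6))
  · exact Or.inr (mem_segment_of_inner h5)

lemma vosZ_im (A B C x : E3) : (vosZ A B C x).im = - o4 A B C x := by
  simp only [vosZ, o4, det3, PiLp.sub_apply]; ring

lemma vosZ_cont (A B C : E3) : Continuous (vosZ A B C) := by
  have h1 : Continuous fun x : E3 => vosN (A - x) (B - x) (C - x) := by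
    unfold vosN; fun_prop
  have h2 : Continuous fun x : E3 => det3 (A - x) (B - x) (C - x) := by
    unfold det3; simp only [PiLp.sub_apply]; fun_prop
  have : vosZ A B C = fun x => (vosN (A - x) (B - x) (C - x) : ℂ) +
      (det3 (A - x) (B - x) (C - x) : ℂ) * Complex.I := by
    funext x
    apply Complex.ext <;> simp [vosZ]
  rw [this]
  fun_prop

lemma vosN_factor (a b c : E3) (s t u : ℝ) (h : s • a + t • b + u • c = 0) :
    2 * (s * t * u) * vosN a b c = - ((s * ‖a‖ + t * ‖b‖ - u * ‖c‖) * (s * ‖a‖ - t * ‖b‖ + u * ‖c‖) *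
      (- (s * ‖a‖) + t * ‖b‖ + u * ‖c‖)) := by
  have g : ∀ (x y z : E3) (p q r : ℝ), p • x + q • y + r • z = 0 →
      2 * p * q * inner ℝ x y = r ^ 2 * ‖z‖ ^ 2 - p ^ 2 * ‖x‖ ^ 2 - q ^ 2 * ‖y‖ ^ 2 := by
    intro x y z p q r h
    have h0 := congrArg (fun w : E3 => w 0) h
    have h1 := congrArg (fun w : E3 => w 1) h
    have h2 := congrArg (fun w : E3 => w 2) h
    simp only [PiLp.add_apply, PiLp.smul_apply, smul_eq_mul, PiLp.zero_apply] at h0 h1 h2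
    simp only [normsq3, inner3]
    linear_combination (p * x 0 + q * y 0 - r * z 0) * h0 + (p * x 1 + q * y 1 - r * z 1) * h1 +
      (p * x 2 + q * y 2 - r * z 2) * h2
  have e1 := g a b c s t u h
  have e2 := g b c a t u s (by rw [← h]; abel)
  have e3 := g c a b u s t (by rw [← h]; abel)
  unfold vosN
  linear_combination u * ‖c‖ * e1 + s * ‖a‖ * e2 + t * ‖b‖ * e3

lemma tri_ineq (a b c : E3) (s t u : ℝ) (h : s • a + t • b + u • c = 0) :
    |u| * ‖c‖ ≤ |s| * ‖a‖ + |t| * ‖b‖ := by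
  have : u • c = - (s • a + t • b) := by
    rw [eq_neg_iff_add_eq_zero, ← h]; abel
  have h1 : ‖u • c‖ ≤ ‖s • a‖ + ‖t • b‖ := by
    rw [this, norm_neg]; exact norm_add_le _ _
  simpa [norm_smul] using h1

lemma vosN_nonpos (a b c : E3) (s t u : ℝ) (h : s • a + t • b + u • c = 0)
    (hs : 0 < s) (ht : 0 < t) (hu : 0 < u) : vosN a b c ≤ 0 := by
  have f := vosN_factor a b c s t u h
  have i1 := tri_ineq a b c s t u h
  have i2 := tri_ineq b c a t u s (by rw [← h]; abel)
  have i3 := tri_ineq c a b u s t (by rw [← h]; abel)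
  rw [abs_of_pos hs, abs_of_pos ht, abs_of_pos hu] at i1 i2 i3
  have p := mul_nonneg (mul_nonneg (sub_nonneg.2 i1) (show 0 ≤ s * ‖a‖ - t * ‖b‖ + u * ‖c‖ by linarith))
    (show 0 ≤ - (s * ‖a‖) + t * ‖b‖ + u * ‖c‖ by linarith)
  have q : 0 < s * t * u := by positivity
  by_contra hc
  have := mul_pos q (not_le.1 hc)
  linarith

lemma vosN_nonneg1 (a b c : E3) (s t u : ℝ) (h : s • a + t • b + u • c = 0)
    (hs : 0 < s) (ht : 0 < t) (hu : u < 0) : 0 ≤ vosN a b c := by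
  have f := vosN_factor a b c s t u h
  have i1 := tri_ineq a b c s t u h
  have i2 := tri_ineq b c a t u s (by rw [← h]; abel)
  have i3 := tri_ineq c a b u s t (by rw [← h]; abel)
  rw [abs_of_pos hs, abs_of_pos ht, abs_of_neg hu] at i1 i2 i3
  have na := mul_nonneg hs.le (norm_nonneg a)
  have nb := mul_nonneg ht.le (norm_nonneg b)
  have nc := mul_nonneg (neg_pos.2 hu).le (norm_nonneg c)
  have p := mul_nonneg (mul_nonneg (show 0 ≤ s * ‖a‖ + t * ‖b‖ - u * ‖c‖ by linarith)
    (show 0 ≤ -(s * ‖a‖ - t * ‖b‖ + u * ‖c‖) by linarith))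
    (show 0 ≤ -(- (s * ‖a‖) + t * ‖b‖ + u * ‖c‖) by linarith)
  have q : s * t * u < 0 := mul_neg_of_pos_of_neg (mul_pos hs ht) hu
  by_contra hc
  have := mul_pos_of_neg_of_neg q (not_le.1 hc)
  linarith

lemma vosN_nonneg2 (a b c : E3) (s t u : ℝ) (h : s • a + t • b + u • c = 0)
    (hs : 0 < s) (ht : t < 0) (hu : u < 0) : 0 ≤ vosN a b c := by
  have f := vosN_factor a b c s t u h
  have i1 := tri_ineq a b c s t u h
  have i2 := tri_ineq b c a t u s (by rw [← h]; abel)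
  have i3 := tri_ineq c a b u s t (by rw [← h]; abel)
  rw [abs_of_pos hs, abs_of_neg ht, abs_of_neg hu] at i1 i2 i3
  have na := mul_nonneg hs.le (norm_nonneg a)
  have nb := mul_nonneg (neg_pos.2 ht).le (norm_nonneg b)
  have nc := mul_nonneg (neg_pos.2 hu).le (norm_nonneg c)
  have p := mul_nonneg (mul_nonneg (show 0 ≤ s * ‖a‖ + t * ‖b‖ - u * ‖c‖ by linarith)
    (show 0 ≤ (s * ‖a‖ - t * ‖b‖ + u * ‖c‖) by linarith))
    (show 0 ≤ -(- (s * ‖a‖) + t * ‖b‖ + u * ‖c‖) by linarith)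
  have q : 0 < s * t * u := mul_pos_of_neg_of_neg (mul_neg_of_pos_of_neg hs ht) hu
  by_contra hc
  have := mul_neg_of_pos_of_neg q (not_le.1 hc)
  linarith

lemma vosN_rot (a b c : E3) : vosN b c a = vosN a b c := by unfold vosN; ring

lemma vosN_nonneg (a b c : E3) (s t u : ℝ) (h : s • a + t • b + u • c = 0) (h1 : s + t + u = 1)
    (hs : s ≠ 0) (ht : t ≠ 0) (hu : u ≠ 0) (hn : ¬ (0 < s ∧ 0 < t ∧ 0 < u)) : 0 ≤ vosN a b c := by
  have r1 : t • b + u • c + s • a = 0 := by rw [← h]; abel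
  have r2 : u • c + s • a + t • b = 0 := by rw [← h]; abel
  rcases lt_or_gt_of_ne hs with ks | ks <;> rcases lt_or_gt_of_ne ht with kt | kt <;>
    rcases lt_or_gt_of_ne hu with ku | ku
  · linarith
  · rw [← vosN_rot, ← vosN_rot]; exact vosN_nonneg2 _ _ _ _ _ _ r2 ku ks kt
  · rw [← vosN_rot]; exact vosN_nonneg2 _ _ _ _ _ _ r1 kt ku ks
  · rw [← vosN_rot]; exact vosN_nonneg1 _ _ _ _ _ _ r1 kt ku ks
  · exact vosN_nonneg2 _ _ _ _ _ _ h ks kt ku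
  · rw [← vosN_rot, ← vosN_rot]; exact vosN_nonneg1 _ _ _ _ _ _ r2 ku ks kt
  · exact vosN_nonneg1 _ _ _ _ _ _ h ks kt ku
  · exact absurd ⟨ks, kt, ku⟩ hn

/-- a continuous logarithm on all of space -/
lemma exists_log (f : E3 → ℂ) (hf : Continuous f) (h0 : ∀ x, f x ≠ 0) :
    ∃ F : E3 → ℂ, Continuous F ∧ ∀ x, Complex.exp (F x) = f x := by
  let g : C(E3, {z : ℂ // z ≠ 0}) := ⟨fun x => ⟨f x, h0 x⟩, by fun_prop⟩
  obtain ⟨F, ⟨-, hF⟩, -⟩ := Complex.isCoveringMap_exp.existsUnique_continuousMap_lifts g 0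
    (Complex.log (f 0)) (Subtype.ext (Complex.exp_log (h0 0)))
  refine ⟨F, F.continuous, fun x => ?_⟩
  exact congrArg Subtype.val (congrFun hF x)

/-- a split link admits a continuous logarithm of `vosZ` along the second component -/
lemma split_log {A B C : E3} {L : Set E3} (h : SplitLink (cycle3 A B C) L) :
    ∃ G : E3 → ℂ, ContinuousOn G L ∧ ∀ x ∈ L, Complex.exp (G x) = vosZ A B C x ∧ x ∉ cycle3 A B C := by
  obtain ⟨H, -, -, -, hK, hL⟩ := h
  let g : E3 → E3 := fun y => !₂[Real.exp (y 0), y 1, y 2]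
  have hg : Continuous g := by
    refine (PiLp.continuous_toLp 2 _).comp (continuous_pi fun i => ?_)
    fin_cases i <;> simp <;> fun_prop
  let f : E3 → ℂ := fun y => vosZ A B C ((H 1).symm (g y))
  have hf : Continuous f := (vosZ_cont A B C).comp ((H 1).symm.continuous.comp hg)
  have h0 : ∀ x, f x ≠ 0 := by
    intro x
    apply vosZ_ne
    intro hx
    have := hK _ hx
    rw [Homeomorph.apply_symm_apply] at this
    have h1 : g x 0 = Real.exp (x 0) := rfl
    rw [h1] at this
    exact absurd this (not_lt.2 (Real.exp_pos _).le)
  obtain ⟨F, hF, hexp⟩ := exists_log f hf h0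
  let k : E3 → E3 := fun x => !₂[Real.log (H 1 x 0), H 1 x 1, H 1 x 2]
  have hH : Continuous (H 1) := (H 1).continuous
  have hk : ContinuousOn k L := by
    refine (PiLp.continuous_toLp 2 _).comp_continuousOn (continuousOn_pi.2 fun i => ?_)
    fin_cases i
    · refine ContinuousOn.log ?_ fun x hx => (hL x hx).ne'
      fun_prop
    · simp; fun_prop
    · simp; fun_prop
  refine ⟨fun x => F (k x), hF.comp_continuousOn hk, fun x hx => ⟨?_, fun hx' => ?_⟩⟩
  · rw [hexp]
    have : g (k x) = H 1 x := by
      ext i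
      fin_cases i
      · simp [g, k, Real.exp_log (hL x hx)]
      · simp [g, k]
      · simp [g, k]
    simp only [f, this, Homeomorph.symm_apply_apply]
  · have := hK x hx'
    have := hL x hx
    linarith

lemma edge_const {W G : ℝ → ℂ} (hW : ContinuousOn W (Set.Icc 0 1)) (hG : ContinuousOn G (Set.Icc 0 1))
    (he : ∀ t ∈ Set.Icc (0:ℝ) 1, Complex.exp (G t) = W t)
    (hs : ∀ t ∈ Set.Icc (0:ℝ) 1, W t ∈ Complex.slitPlane) :
    (G 1).im - Complex.arg (W 1) = (G 0).im - Complex.arg (W 0) := by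
  have hc : ContinuousOn (fun t => G t - Complex.log (W t)) (Set.Icc 0 1) :=
    hG.sub (hW.clog hs)
  have hm : Set.MapsTo (fun t => G t - Complex.log (W t)) (Set.Icc 0 1)
      (AddSubgroup.zmultiples (2 * Real.pi * Complex.I) : Set ℂ) := by
    intro t ht
    have h1 : Complex.exp (G t) = Complex.exp (Complex.log (W t)) := by
      rw [he t ht, Complex.exp_log (Complex.slitPlane_ne_zero (hs t ht))]
    obtain ⟨n, hn⟩ := Complex.exp_eq_exp_iff_exists_int.1 h1
    refine AddSubgroup.mem_zmultiples_iff.2 ⟨n, ?_⟩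
    simp [hn]
  have hd : IsDiscrete (AddSubgroup.zmultiples (2 * Real.pi * Complex.I) : Set ℂ) :=
    ⟨NormedSpace.discreteTopology_zmultiples _⟩
  have := (isPreconnected_Icc (a := (0:ℝ)) (b := 1)).constant_of_mapsTo hd hc hm (x := 1) (y := 0)
    (by simp) (by simp)
  have := congrArg Complex.im this
  simpa [Complex.log_im] using this

lemma o4_line {A B C X Y : E3} {x : E3} (s t : ℝ) (hst : s + t = 1) (hx : x = s • X + t • Y)
    (h0 : o4 A B C x = 0) (hX : o4 A B C X ≠ 0) (hY : o4 A B C Y ≠ 0) (hs : 0 ≤ s) (ht : 0 ≤ t) :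
    ∃ d : ℝ, d ≠ 0 ∧ d = o4 A B C Y - o4 A B C X ∧ s = o4 A B C Y / d ∧ t = - o4 A B C X / d ∧
     0 < s ∧ 0 < t := by
  rw [hx, o4_comb2 _ _ _ _ _ _ _ hst] at h0
  set p := o4 A B C X
  set q := o4 A B C Y
  have hd : q - p ≠ 0 := by
    intro h
    have h1 : q = p := by linarith
    rw [h1, ← add_mul, hst, one_mul] at h0
    exact hX h0
  have e1 : s = q / (q - p) := by
    rw [eq_div_iff hd]; 
    have : t = 1 - s := by linarith
    rw [this] at h0
    linarith
  have e2 : t = -p / (q - p) := by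
    rw [eq_div_iff hd]; 
    have : s = 1 - t := by linarith
    rw [this] at h0
    linarith
  refine ⟨q - p, hd, rfl, e1, e2, lt_of_le_of_ne hs ?_, lt_of_le_of_ne ht ?_⟩
  · rw [e1]; exact (div_ne_zero hY hd).symm
  · rw [e2]; exact (div_ne_zero (neg_ne_zero.2 hX) hd).symm

lemma cross_pt {A B C X Y x : E3} (hX : o4 A B C X ≠ 0) (hY : o4 A B C Y ≠ 0)
    (h1 : o4 X Y B C ≠ 0) (h2 : o4 X Y C A ≠ 0) (h3 : o4 X Y A B ≠ 0)
    (hx : x ∈ segment ℝ X Y) (h0 : o4 A B C x = 0) :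
    ∃ a b c : ℝ, a + b + c = 1 ∧ x = a • A + b • B + c • C ∧ a ≠ 0 ∧ b ≠ 0 ∧ c ≠ 0 ∧
      (Pierces A B C X Y ↔ (0 < a ∧ 0 < b ∧ 0 < c)) := by
  obtain ⟨s, t, hs, ht, hst, rfl⟩ := hx
  obtain ⟨d, hd, hd', es, et, hs', ht'⟩ := o4_line s t hst rfl h0 hX hY hs ht
  have hsum := radon_coeff A B C X Y
  have hpt := radon_pt A B C X Y
  have hpi := pierces_iff hX hY h1 h2 h3
  rw [← hd'] at hsum
  have hpt2 : s • X + t • Y = (o4 X Y B C / d) • A + (o4 X Y C A / d) • B + (o4 X Y A B / d) • C := by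
    have := congrArg (fun z => d⁻¹ • z) hpt
    simp only [smul_add, smul_sub, smul_smul] at this
    simp only [es, et, div_eq_mul_inv]
    rw [mul_comm (o4 X Y B C), mul_comm (o4 X Y C A), mul_comm (o4 X Y A B), this]
    module
  have hsum2 : o4 X Y B C / d + o4 X Y C A / d + o4 X Y A B / d = 1 := by
    rw [← add_div, ← add_div, hsum, div_self hd]
  refine ⟨o4 X Y B C / d, o4 X Y C A / d, o4 X Y A B / d, hsum2, hpt2, div_ne_zero h1 hd, div_ne_zero h2 hd,
    div_ne_zero h3 hd, ?_, ?_⟩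
  · intro hP
    obtain ⟨g0, g1, g2⟩ := hpi.1 hP
    by_cases k : 0 < o4 X Y B C
    · have k2 := g2.1 k
      have k3 := g1.2 k
      have : 0 < d := by linarith
      exact ⟨div_pos k this, div_pos k2 this, div_pos k3 this⟩
    · have k2 : o4 X Y C A < 0 := lt_of_le_of_ne (not_lt.1 fun h => k (g2.2 h)) h2
      have k3 : o4 X Y A B < 0 := lt_of_le_of_ne (not_lt.1 fun h => k (g1.1 h)) h3
      have k1 : o4 X Y B C < 0 := lt_of_le_of_ne (not_lt.1 k) h1
      have : d < 0 := by linarith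
      exact ⟨div_pos_of_neg_of_neg k1 this, div_pos_of_neg_of_neg k2 this, div_pos_of_neg_of_neg k3 this⟩
  · rintro ⟨k1, k2, k3⟩
    exact ⟨_, ⟨s, t, hs', ht', hst, rfl⟩, _, _, _, k1, k2, k3, hsum2, hpt2⟩

lemma bary_zero {A B C x : E3} {a b c : ℝ} (h : a + b + c = 1) (hx : x = a • A + b • B + c • C) :
    a • (A - x) + b • (B - x) + c • (C - x) = 0 := by
  have : a • (A - x) + b • (B - x) + c • (C - x) = (a • A + b • B + c • C) - (a + b + c) • x := by module
  rw [this, h, ← hx, one_smul, sub_self]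

lemma edge_jump {A B C X Y : E3} {L : Set E3} {G : E3 → ℂ} (hG : ContinuousOn G L)
    (he : ∀ x ∈ L, Complex.exp (G x) = vosZ A B C x ∧ x ∉ cycle3 A B C) (hL : segment ℝ X Y ⊆ L)
    (hX : o4 A B C X ≠ 0) (hY : o4 A B C Y ≠ 0)
    (h1 : o4 X Y B C ≠ 0) (h2 : o4 X Y C A ≠ 0) (h3 : o4 X Y A B ≠ 0) :
    ((G Y).im - (vosZ A B C Y).arg) - ((G X).im - (vosZ A B C X).arg) =
      - 2 * Real.pi * edgeSign A B C X Y := by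
  let ℓ : ℝ → E3 := fun t => (1 - t) • X + t • Y
  have hℓc : Continuous ℓ := by fun_prop
  have hℓ : ∀ t ∈ Set.Icc (0:ℝ) 1, ℓ t ∈ segment ℝ X Y := by
    intro t ht
    exact ⟨1 - t, t, by linarith [ht.2], ht.1, by ring, rfl⟩
  have hGc : ContinuousOn (fun t => G (ℓ t)) (Set.Icc 0 1) :=
    hG.comp hℓc.continuousOn fun t ht => hL (hℓ t ht)
  have l0 : ℓ 0 = X := by simp [ℓ]
  have l1 : ℓ 1 = Y := by simp [ℓ]
  have hWc : Continuous (fun t => vosZ A B C (ℓ t)) := (vosZ_cont A B C).comp hℓc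
  have hre : ∀ t ∈ Set.Icc (0:ℝ) 1, (vosZ A B C (ℓ t)).im = 0 →
      (Pierces A B C X Y → (vosZ A B C (ℓ t)).re < 0) ∧
      (¬ Pierces A B C X Y → 0 < (vosZ A B C (ℓ t)).re) := by
    intro t ht him
    have hne : (vosZ A B C (ℓ t)).re ≠ 0 := by
      intro hr
      exact vosZ_ne (he _ (hL (hℓ t ht))).2 (Complex.ext hr him)
    rw [vosZ_im, neg_eq_zero] at him
    obtain ⟨a, b, c, habc, hx, ha, hb, hc, hiff⟩ := cross_pt hX hY h1 h2 h3 (hℓ t ht) him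
    have hz := bary_zero habc hx
    constructor
    · intro hP
      obtain ⟨ka, kb, kc⟩ := hiff.1 hP
      exact lt_of_le_of_ne (vosN_nonpos _ _ _ _ _ _ hz ka kb kc) hne
    · intro hP
      exact lt_of_le_of_ne (vosN_nonneg _ _ _ _ _ _ hz habc ha hb hc (fun k => hP (hiff.2 k))) hne.symm
  by_cases hP : Pierces A B C X Y
  · have key := edge_const (W := fun t => - vosZ A B C (ℓ t))
      (G := fun t => G (ℓ t) + Real.pi * Complex.I) hWc.neg.continuousOn
      (hGc.add continuousOn_const) (by
        intro t ht
        rw [Complex.exp_add, Complex.exp_pi_mul_I, (he _ (hL (hℓ t ht))).1, mul_neg_one]) (by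
        intro t ht
        by_cases him : (vosZ A B C (ℓ t)).im = 0
        · left
          have := (hre t ht him).1 hP
          simp only [Complex.neg_re]; linarith
        · right
          simpa using him)
    simp only [l0, l1] at key
    have g0 := ((pierces_iff hX hY h1 h2 h3).1 hP).1
    have hd : det3 (B - A) (C - A) (X - A) = o4 A B C X := rfl
    rw [edgeSign, if_pos hP, hd]
    by_cases k : 0 < o4 A B C X
    · have kY : o4 A B C Y < 0 := lt_of_le_of_ne (not_lt.1 (g0.1 k)) hY
      rw [Complex.arg_neg_eq_arg_sub_pi_of_im_pos (x := vosZ A B C Y) (by rw [vosZ_im]; linarith),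
        Complex.arg_neg_eq_arg_add_pi_of_im_neg (x := vosZ A B C X) (by rw [vosZ_im]; linarith)] at key
      rw [if_pos k]
      simp at key ⊢
      linarith
    · have kX : o4 A B C X < 0 := lt_of_le_of_ne (not_lt.1 k) hX
      have kY : 0 < o4 A B C Y := by
        by_contra h
        exact k (g0.2 h)
      rw [Complex.arg_neg_eq_arg_sub_pi_of_im_pos (x := vosZ A B C X) (by rw [vosZ_im]; linarith),
        Complex.arg_neg_eq_arg_add_pi_of_im_neg (x := vosZ A B C Y) (by rw [vosZ_im]; linarith)] at key
      rw [if_neg k]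
      simp at key ⊢
      linarith
  · have key := edge_const (W := fun t => vosZ A B C (ℓ t))
      (G := fun t => G (ℓ t)) hWc.continuousOn hGc (fun t ht => (he _ (hL (hℓ t ht))).1) (by
        intro t ht
        by_cases him : (vosZ A B C (ℓ t)).im = 0
        · left
          exact (hre t ht him).2 hP
        · right
          exact him)
    simp only [l0, l1] at key
    rw [edgeSign, if_neg hP]
    simp
    linarith


/-- The conditions of general position of an edge with respect to a triangle. -/
structure EdgeGP (A B C X Y : E3) : Prop where
  hX : o4 A B C X ≠ 0
  hY : o4 A B C Y ≠ 0
  h1 : o4 X Y B C ≠ 0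
  h2 : o4 X Y C A ≠ 0
  h3 : o4 X Y A B ≠ 0

lemma split_lk_zero {A B C D E F G : E3} (g1 : EdgeGP A B C D E) (g2 : EdgeGP A B C E F)
    (g3 : EdgeGP A B C F G) (g4 : EdgeGP A B C G D)
    (h : SplitLink (cycle3 A B C) (cycle4 D E F G)) : lkTriQuad A B C D E F G = 0 := by
  obtain ⟨W, hW, he⟩ := split_log h
  have s1 : segment ℝ D E ⊆ cycle4 D E F G := fun x hx => Or.inl (Or.inl (Or.inl hx))
  have s2 : segment ℝ E F ⊆ cycle4 D E F G := fun x hx => Or.inl (Or.inl (Or.inr hx))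
  have s3 : segment ℝ F G ⊆ cycle4 D E F G := fun x hx => Or.inl (Or.inr hx)
  have s4 : segment ℝ G D ⊆ cycle4 D E F G := fun x hx => Or.inr hx
  have j1 := edge_jump hW he s1 g1.hX g1.hY g1.h1 g1.h2 g1.h3
  have j2 := edge_jump hW he s2 g2.hX g2.hY g2.h1 g2.h2 g2.h3
  have j3 := edge_jump hW he s3 g3.hX g3.hY g3.h1 g3.h2 g3.h3
  have j4 := edge_jump hW he s4 g4.hX g4.hY g4.h1 g4.h2 g4.h3
  have hs : Real.pi * ((edgeSign A B C D E : ℝ) + edgeSign A B C E F + edgeSign A B C F G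
      + edgeSign A B C G D) = 0 := by linarith
  have := (mul_eq_zero.1 hs).resolve_left Real.pi_ne_zero
  unfold lkTriQuad
  exact_mod_cast this

lemma edgeGP_of {v : Fin 7 → E3} (hv : GenPos7 v) (a b c x y : Fin 7) (h : [a, b, c, x, y].Nodup) :
    EdgeGP (v a) (v b) (v c) (v x) (v y) := by
  simp only [List.nodup_cons, List.mem_cons, not_or, List.not_mem_nil, not_false_eq_true] at h
  obtain ⟨⟨h1, h2, h3, h4, -⟩, ⟨h5, h6, h7, -⟩, ⟨h8, h9, -⟩, ⟨h10, -⟩, -⟩ := h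
  constructor
  · exact gp_o4 hv _ _ _ _ h1 h2 h3 h5 h6 h8
  · exact gp_o4 hv _ _ _ _ h1 h2 h4 h5 h7 h9
  · exact gp_o4 hv _ _ _ _ h10 (Ne.symm h6) (Ne.symm h8) (Ne.symm h7) (Ne.symm h9) h5
  · exact gp_o4 hv _ _ _ _ h10 (Ne.symm h8) (Ne.symm h3) (Ne.symm h9) (Ne.symm h4) (Ne.symm h2)
  · exact gp_o4 hv _ _ _ _ h10 (Ne.symm h3) (Ne.symm h6) (Ne.symm h4) (Ne.symm h7) h1

lemma nodup_all : ∀ a b : Fin 3,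
    [6, odds a, evens b, odds (a+1), evens (b+1)].Nodup ∧
    [6, odds a, evens b, evens (b+1), odds (a+2)].Nodup ∧
    [6, odds a, evens b, odds (a+2), evens (b+2)].Nodup ∧
    [6, odds a, evens b, evens (b+2), odds (a+1)].Nodup := by decide

lemma split_lk331 {v : Fin 7 → E3} (hv : GenPos7 v) (a b : Fin 3)
    (h : SplitLink (triOf v a b) (quadOf v a b)) : lk331 v a b = 0 := by
  obtain ⟨n1, n2, n3, n4⟩ := nodup_all a b
  exact split_lk_zero (edgeGP_of hv _ _ _ _ _ n1) (edgeGP_of hv _ _ _ _ _ n2)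
    (edgeGP_of hv _ _ _ _ _ n3) (edgeGP_of hv _ _ _ _ _ n4) h

/-- An ambient isotopy of space. -/
def Isot (H : ℝ → (E3 ≃ₜ E3)) : Prop :=
  Continuous (fun q : ℝ × E3 => H q.1 q.2) ∧ Continuous (fun q : ℝ × E3 => (H q.1).symm q.2) ∧
    ∀ x, H 0 x = x

/-- Predicates of pairs of sets that can be pulled back along ambient isotopies. -/
def IsoInv (Q : Set E3 → Set E3 → Prop) : Prop :=
  ∀ H, Isot H → ∀ K L, Q (H 1 '' K) (H 1 '' L) → Q K L

lemma Isot.symm {H : ℝ → (E3 ≃ₜ E3)} (h : Isot H) : Isot (fun t => (H t).symm) := by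
  refine ⟨h.2.1, h.1, fun x => ?_⟩
  have := h.2.2 x
  calc (H 0).symm x = (H 0).symm (H 0 x) := by rw [this]
    _ = x := by simp

lemma IsoInv.iff {Q : Set E3 → Set E3 → Prop} (hQ : IsoInv Q) {H : ℝ → (E3 ≃ₜ E3)} (h : Isot H)
    (K L : Set E3) : Q (H 1 '' K) (H 1 '' L) ↔ Q K L := by
  refine ⟨hQ H h K L, fun hKL => hQ _ h.symm _ _ ?_⟩
  simpa [Set.image_image] using hKL

lemma isoInv_split : IsoInv SplitLink := by
  rintro H ⟨h1, h2, h3⟩ K L ⟨J, j1, j2, j3, j4, j5⟩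
  refine ⟨fun t => (H t).trans (J t), ?_, ?_, ?_, ?_, ?_⟩
  · exact j1.comp (continuous_fst.prodMk h1)
  · exact h2.comp (continuous_fst.prodMk j2)
  · intro x; simp [h3, j3]
  · intro x hx; exact j4 _ ⟨x, hx, rfl⟩
  · intro x hx; exact j5 _ ⟨x, hx, rfl⟩

lemma isoInv_flip {Q : Set E3 → Set E3 → Prop} (hQ : IsoInv Q) : IsoInv (fun K L => Q L K) :=
  fun H h K L => hQ H h L K

/-- a small multiple of a Lipschitz vector field moves space by an isotopy -/
lemma local_isot {g : E3 → E3} {C : NNReal} (hg : LipschitzWith C g) {s : ℝ} (hs : |s| * C ≤ 1 / 2) :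
    ∃ H, Isot H ∧ ∀ x, H 1 x = x + s • g x := by
  let c : ℝ → ℝ := fun τ => max 0 (min τ 1) * s
  have hc : Continuous c := by fun_prop
  have hcs : ∀ τ, |c τ| ≤ |s| := by
    intro τ
    rw [abs_mul]
    have : |max 0 (min τ 1)| ≤ 1 := by
      rw [abs_of_nonneg (le_max_left _ _)]
      exact max_le (by norm_num) (min_le_right _ _)
    calc _ ≤ 1 * |s| := mul_le_mul_of_nonneg_right this (abs_nonneg _)
      _ = _ := one_mul _
  have hgl : ∀ x y, ‖g x - g y‖ ≤ C * ‖x - y‖ := fun x y => by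
    simpa [dist_eq_norm] using hg.dist_le_mul x y
  have hsm : ∀ τ x y, ‖c τ • g x - c τ • g y‖ ≤ 1 / 2 * ‖x - y‖ := by
    intro τ x y
    rw [← smul_sub, norm_smul, Real.norm_eq_abs]
    calc |c τ| * ‖g x - g y‖ ≤ |s| * (C * ‖x - y‖) :=
          mul_le_mul (hcs τ) (hgl x y) (norm_nonneg _) (abs_nonneg _)
      _ = (|s| * C) * ‖x - y‖ := by ring
      _ ≤ _ := mul_le_mul_of_nonneg_right hs (norm_nonneg _)
  have happ : ∀ τ, ApproximatesLinearOn (fun x => x + c τ • g x)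
      ((ContinuousLinearEquiv.refl ℝ E3 : E3 ≃L[ℝ] E3) : E3 →L[ℝ] E3) Set.univ (1 / 2) := by
    intro τ x _ y _
    have : x + c τ • g x - (y + c τ • g y) - (x - y) = c τ • g x - c τ • g y := by abel
    simpa [this] using hsm τ x y
  have hN : Subsingleton E3 ∨ (1 / 2 : NNReal) <
      ‖((ContinuousLinearEquiv.refl ℝ E3).symm : E3 →L[ℝ] E3)‖₊⁻¹ := by
    right
    have : ‖((ContinuousLinearEquiv.refl ℝ E3).symm : E3 →L[ℝ] E3)‖₊ = 1 := by
      ext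
      exact ContinuousLinearMap.norm_id
    rw [this]
    norm_num
  let H : ℝ → (E3 ≃ₜ E3) := fun τ => (happ τ).toHomeomorph _ hN
  have hH : ∀ τ x, H τ x = x + c τ • g x := fun τ x => rfl
  have hanti : ∀ τ x y, ‖x - y‖ ≤ 2 * ‖H τ x - H τ y‖ := by
    intro τ x y
    have e : x - y = (H τ x - H τ y) - (c τ • g x - c τ • g y) := by
      rw [hH, hH]; abel
    have h1 := hsm τ x y
    have h2 : ‖x - y‖ ≤ ‖H τ x - H τ y‖ + ‖c τ • g x - c τ • g y‖ := by
      conv_lhs => rw [e]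
      exact norm_sub_le _ _
    linarith
  have hcont : Continuous (fun q : ℝ × E3 => H q.1 q.2) := by
    simp only [hH]
    have := hg.continuous
    fun_prop
  refine ⟨H, ⟨hcont, ?_, ?_⟩, ?_⟩
  · rw [continuous_iff_continuousAt]
    rintro ⟨τ0, y0⟩
    set x0 := (H τ0).symm y0 with hx0
    have hb : ∀ q : ℝ × E3, dist ((H q.1).symm q.2) x0 ≤ 2 * ‖q.2 - H q.1 x0‖ := by
      intro q
      have := hanti q.1 ((H q.1).symm q.2) x0
      rwa [Homeomorph.apply_symm_apply, ← dist_eq_norm] at this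
    have hlim : Filter.Tendsto (fun q : ℝ × E3 => 2 * ‖q.2 - H q.1 x0‖) (nhds (τ0, y0)) (nhds 0) := by
      have hc2 : Continuous (fun q : ℝ × E3 => 2 * ‖q.2 - H q.1 x0‖) := by
        have : Continuous (fun q : ℝ × E3 => H q.1 x0) :=
          hcont.comp (continuous_fst.prodMk continuous_const)
        fun_prop
      have := hc2.tendsto (τ0, y0)
      simpa [hx0] using this
    exact tendsto_iff_dist_tendsto_zero.2
      (squeeze_zero (fun _ => dist_nonneg) hb hlim)
  · intro x; simp [hH, c]
  · intro x; simp [hH, c]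

/-- moving one component by an affine path avoiding the other component -/
theorem path_move {Q : Set E3 → Set E3 → Prop} (hQ : IsoInv Q) (w : E3 →ᵃ[ℝ] E3) {K L : Set E3}
    (hK : IsCompact K) (hL : IsClosed L)
    (hinj : ∀ t ∈ Set.Icc (0:ℝ) 1, Function.Injective fun x => x + t • w x)
    (hdis : ∀ t ∈ Set.Icc (0:ℝ) 1, ∀ x ∈ K, x + t • w x ∉ L)
    (h : Q ((fun x => x + w x) '' K) L) : Q K L := by
  let M : ℝ → E3 → E3 := fun t x => x + t • w x
  have hwc : Continuous w := w.continuous_of_finiteDimensional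
  have hMc : ∀ t, Continuous (M t) := fun t => by fun_prop
  have key : ∀ t ∈ Set.Icc (0:ℝ) 1, ∃ ε > 0, ∀ s : ℝ, |s| < ε →
      (Q (M (t + s) '' K) L ↔ Q (M t '' K) L) := by
    intro t ht
    -- the linear part
    let l : E3 →ₗ[ℝ] E3 := LinearMap.id + t • w.linear
    have hl : ∀ x y, M t x - M t y = l (x - y) := by
      intro x y
      have : w x - w y = w.linear (x - y) := (w.linearMap_vsub x y).symm
      simp only [M, l, LinearMap.add_apply, LinearMap.smul_apply, ← this, LinearMap.id_apply]
      module
    have hker : LinearMap.ker l = ⊥ := by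
      rw [LinearMap.ker_eq_bot']
      intro m hm
      have := hl m 0
      rw [sub_zero, hm, sub_eq_zero] at this
      exact hinj t ht this
    obtain ⟨a, ha, hla⟩ := l.exists_antilipschitzWith hker
    have hMa : ∀ x y, ‖x - y‖ ≤ a * ‖M t x - M t y‖ := by
      intro x y
      have := hla.le_mul_dist (x - y) 0
      rwa [dist_zero_right, map_zero, dist_zero_right, ← hl] at this
    obtain ⟨B, hB⟩ := (hK.image hwc).isBounded.exists_norm_le
    have hB' : ∀ x ∈ K, ‖w x‖ ≤ max B 0 := fun x hx => (hB _ ⟨x, hx, rfl⟩).trans (le_max_left _ _)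
    set wl := w.linear.toContinuousLinearMap
    have hwl : ∀ x y, ‖w x - w y‖ ≤ ‖wl‖ * ‖x - y‖ := by
      intro x y
      have : w x - w y = wl (x - y) := (w.linearMap_vsub x y).symm
      rw [this]; exact wl.le_opNorm _
    have hd : Disjoint (M t '' K) L := by
      rw [Set.disjoint_left]
      rintro _ ⟨x, hx, rfl⟩
      exact hdis t ht x hx
    obtain ⟨δ, hδ, hδ'⟩ := Metric.exists_pos_forall_lt_edist (hK.image (hMc t)) hL hd
    have hsep : ∀ x ∈ K, ∀ y ∈ L, (δ:ℝ) ≤ ‖M t x - y‖ := by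
      intro x hx y hy
      have := hδ' _ ⟨x, hx, rfl⟩ y hy
      rw [edist_nndist, ENNReal.coe_lt_coe] at this
      rw [← dist_eq_norm]
      exact_mod_cast this.le
    let g : E3 → E3 := fun y => if y ∈ L then 0 else w (Function.invFun (M t) y)
    have hgK : ∀ x ∈ K, g (M t x) = w x := by
      intro x hx
      have h0 : M t x ∉ L := hdis t ht x hx
      simp only [g, if_neg h0]
      exact congrArg w (Function.leftInverse_invFun (hinj t ht) x)
    have hgL : ∀ y ∈ L, g y = 0 := fun y hy => if_pos hy
    have hδR : (0:ℝ) < δ := by exact_mod_cast hδ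
    have mixed : ∀ x ∈ K, ∀ y ∈ L, ‖w x‖ ≤ (max B 0 / δ) * ‖M t x - y‖ := by
      intro x hx y hy
      calc ‖w x‖ ≤ max B 0 := hB' x hx
        _ = (max B 0 / δ) * δ := by field_simp
        _ ≤ _ := mul_le_mul_of_nonneg_left (hsep x hx y hy) (by positivity)
    let C1 : ℝ := ‖wl‖ * a + max B 0 / δ
    have hC1 : 0 ≤ C1 := by positivity
    have hC1a : ‖wl‖ * a ≤ C1 := le_add_of_nonneg_right (by positivity)
    have hC1b : max B 0 / δ ≤ C1 := le_add_of_nonneg_left (by positivity)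
    have hlip : LipschitzOnWith C1.toNNReal g (M t '' K ∪ L) := by
      apply LipschitzOnWith.of_dist_le_mul
      simp only [dist_eq_norm, Real.coe_toNNReal _ hC1]
      rintro y (⟨x, hx, rfl⟩ | hy) y' (⟨x', hx', rfl⟩ | hy')
      · rw [hgK x hx, hgK x' hx']
        calc _ ≤ ‖wl‖ * ‖x - x'‖ := hwl x x'
          _ ≤ ‖wl‖ * (a * ‖M t x - M t x'‖) := mul_le_mul_of_nonneg_left (hMa _ _) (norm_nonneg _)
          _ = (‖wl‖ * a) * ‖M t x - M t x'‖ := by ring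
          _ ≤ _ := mul_le_mul_of_nonneg_right hC1a (norm_nonneg _)
      · rw [hgK x hx, hgL y' hy', sub_zero]
        exact (mixed x hx y' hy').trans (mul_le_mul_of_nonneg_right hC1b (norm_nonneg _))
      · rw [hgL y hy, hgK x' hx', zero_sub, norm_neg, norm_sub_rev]
        exact (mixed x' hx' y hy).trans (mul_le_mul_of_nonneg_right hC1b (norm_nonneg _))
      · rw [hgL y hy, hgL y' hy', sub_self, norm_zero]
        positivity
    obtain ⟨G, hG, hGe⟩ := hlip.extend_finite_dimension
    set C := lipschitzExtensionConstant E3 * C1.toNNReal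
    refine ⟨1 / (2 * (C + 1)), by positivity, fun s hs => ?_⟩
    have hsC : |s| * C ≤ 1 / 2 := by
      have hC0 : (0:ℝ) ≤ C := C.2
      calc |s| * C ≤ 1 / (2 * (C + 1)) * (C + 1) :=
            mul_le_mul hs.le (by linarith) hC0 (by positivity)
        _ = 1 / 2 := by field_simp
    obtain ⟨H, hH, hH1⟩ := local_isot hG hsC
    have i1 : H 1 '' (M t '' K) = M (t + s) '' K := by
      rw [Set.image_image]
      apply Set.image_congr
      intro x hx
      rw [hH1, ← hGe (Or.inl ⟨x, hx, rfl⟩), hgK x hx]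
      simp only [M]; module
    have i2 : H 1 '' L = L := by
      have : Set.EqOn (H 1) id L := by
        intro y hy
        rw [hH1, ← hGe (Or.inr hy), hgL y hy]; simp
      rw [this.image_eq, Set.image_id]
    have := hQ.iff hH (M t '' K) L
    rwa [i1, i2] at this
  have conn := (isPreconnected_Icc (a := (0:ℝ)) (b := 1)).induction₂
    (fun x y => (Q (M x '' K) L ↔ Q (M y '' K) L)) (by
      intro t ht
      obtain ⟨ε, hε, hs⟩ := key t ht
      refine mem_nhdsWithin_of_mem_nhds (Filter.mem_of_superset (Metric.ball_mem_nhds t hε) ?_)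
      intro y hy
      have := hs (y - t) (by simpa [Real.dist_eq] using hy)
      rw [add_sub_cancel] at this
      exact this.symm)
    (fun x y z _ _ _ h1 h2 => h1.trans h2) (fun x y _ _ h => h.symm)
    (show (0:ℝ) ∈ Set.Icc (0:ℝ) 1 by simp) (show (1:ℝ) ∈ Set.Icc (0:ℝ) 1 by simp)
  have e0 : M 0 '' K = K := by simp [M]
  have e1 : M 1 '' K = (fun x => x + w x) '' K := by simp [M]
  rw [e0, e1] at conn
  exact conn.2 h

lemma half_space_split {K L : Set E3} (k : ℝ) (hK : ∀ x ∈ K, x 0 < k) (hL : ∀ x ∈ L, k < x 0) :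
    SplitLink K L := by
  let e : E3 := EuclideanSpace.single 0 (1:ℝ)
  refine ⟨fun t => Homeomorph.addRight (-(t * k) • e), ?_, ?_, ?_, ?_, ?_⟩
  · simp only [Homeomorph.coe_addRight]
    fun_prop
  · simp only [Homeomorph.addRight_symm, Homeomorph.coe_addRight]
    fun_prop
  · intro x; simp
  · intro x hx; have := hK x hx; simp [e]; linarith
  · intro x hx; have := hL x hx; simp [e]; linarith

lemma span_pair_ne_top (a b : E3) : Submodule.span ℝ ({a, b} : Set E3) ≠ ⊤ := by
  intro h
  have h1 := finrank_span_finset_le_card (R := ℝ) ({a, b} : Finset E3)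
  have h2 : Set.finrank ℝ ((({a, b} : Finset E3)) : Set E3) = 3 := by
    have e : ((({a, b} : Finset E3)) : Set E3) = {a, b} := by ext; simp
    rw [e]
    unfold Set.finrank
    rw [h, finrank_top]
    simp
  have h3 := Finset.card_le_two (a := a) (b := b)
  omega

/-- a direction avoiding finitely many segments -/
lemma exists_dir (c : E3) (l : List (E3 × E3)) (hl : ∀ p ∈ l, c ∉ segment ℝ p.1 p.2) :
    ∃ u : E3, u 0 < 0 ∧ ∀ p ∈ l, ∀ s : ℝ, c + s • u ∉ segment ℝ p.1 p.2 := by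
  let H0 : Submodule ℝ E3 := LinearMap.ker (EuclideanSpace.proj 0 : E3 →L[ℝ] ℝ).toLinearMap
  let S : Finset (Submodule ℝ E3) :=
    insert H0 ((l.map fun p => Submodule.span ℝ {p.1 - c, p.2 - c}).toFinset)
  have hS : ⊤ ∉ S := by
    simp only [S, Finset.mem_insert, List.mem_toFinset, List.mem_map, not_or, not_exists, not_and]
    refine ⟨?_, fun p _ h => span_pair_ne_top _ _ h⟩
    intro h
    have : EuclideanSpace.single 0 (1:ℝ) ∈ H0 := by rw [← h]; trivial
    simp [H0] at this
  have hne := Subspace.biUnion_ne_univ_of_top_notMem hS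
  obtain ⟨u, hu⟩ := (Set.ne_univ_iff_exists_notMem _).1 hne
  simp only [Set.mem_iUnion, not_exists, SetLike.mem_coe] at hu
  have hu0 : u 0 ≠ 0 := by
    intro h
    exact hu H0 (Finset.mem_insert_self _ _) (by simpa [H0] using h)
  have key : ∀ p ∈ l, ∀ s : ℝ, c + s • u ∉ segment ℝ p.1 p.2 := by
    intro p hp s hs
    have hs0 : s ≠ 0 := by
      rintro rfl
      apply hl p hp
      simpa using hs
    apply hu (Submodule.span ℝ {p.1 - c, p.2 - c})
      (Finset.mem_insert_of_mem (by simpa using ⟨p.1, p.2, hp, rfl⟩))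
    obtain ⟨a, b, -, -, hab, he⟩ := hs
    rw [Submodule.mem_span_pair]
    refine ⟨s⁻¹ * a, s⁻¹ * b, ?_⟩
    have h2 : u = s⁻¹ • (c + s • u - c) := by
      rw [add_sub_cancel_left, smul_smul, inv_mul_cancel₀ hs0, one_smul]
    rw [h2, ← he]
    have : c = (a + b) • c := by rw [hab, one_smul]
    conv_rhs => rw [this]
    module
  rcases lt_or_gt_of_ne hu0 with h | h
  · exact ⟨u, h, key⟩
  · refine ⟨-u, by simpa using h, fun p hp s => ?_⟩
    have := key p hp (-s)
    simpa using this

lemma isCompact_segment (a b : E3) : IsCompact (segment ℝ a b) := by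
  rw [← convexHull_pair]
  exact (Set.toFinite {a, b}).isCompact_convexHull (𝕜 := ℝ)

lemma isCompact_cycle3 (A B C : E3) : IsCompact (cycle3 A B C) :=
  ((isCompact_segment _ _).union (isCompact_segment _ _)).union (isCompact_segment _ _)

lemma isCompact_cycle4 (A B C D : E3) : IsCompact (cycle4 A B C D) :=
  (((isCompact_segment _ _).union (isCompact_segment _ _)).union (isCompact_segment _ _)).union
    (isCompact_segment _ _)

lemma coord_bound {K : Set E3} (hK : IsCompact K) : ∃ R : ℝ, ∀ x ∈ K, |x 0| ≤ R := by
  obtain ⟨R, hR⟩ := hK.isBounded.exists_norm_le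
  refine ⟨R, fun x hx => (le_trans ?_ (hR x hx))⟩
  exact PiLp.norm_apply_le x 0

theorem disjoint_split {K T : Set E3} (hK : IsCompact K) (hT : Convex ℝ T) (hKT : K ⊆ T) {c : E3}
    (hc : c ∈ T) {D E F G : E3} (hd : ∀ x ∈ T, x ∉ cycle4 D E F G) :
    SplitLink K (cycle4 D E F G) := by
  set L := cycle4 D E F G with hLdef
  have hLc : IsCompact L := isCompact_cycle4 _ _ _ _
  obtain ⟨u, hu0, hu⟩ := exists_dir c [(D, E), (E, F), (F, G), (G, D)] (by
    intro p hp h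
    simp only [List.mem_cons, List.not_mem_nil, or_false] at hp
    apply hd c hc
    rcases hp with rfl | rfl | rfl | rfl
    · exact Or.inl (Or.inl (Or.inl h))
    · exact Or.inl (Or.inl (Or.inr h))
    · exact Or.inl (Or.inr h)
    · exact Or.inr h)
  have hray : ∀ s : ℝ, c + s • u ∉ L := by
    rintro s (((h | h) | h) | h)
    · exact hu (D, E) (by simp) s h
    · exact hu (E, F) (by simp) s h
    · exact hu (F, G) (by simp) s h
    · exact hu (G, D) (by simp) s h
  obtain ⟨R1, hR1⟩ := coord_bound hK
  obtain ⟨R2, hR2⟩ := coord_bound hLc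
  let R := max (max R1 R2) |c 0|
  have hRK : ∀ x ∈ K, x 0 ≤ R := fun x hx =>
    (le_abs_self _).trans ((hR1 x hx).trans ((le_max_left _ _).trans (le_max_left _ _)))
  have hRL : ∀ x ∈ L, - R ≤ x 0 := fun x hx =>
    (abs_le.1 ((hR2 x hx).trans ((le_max_right _ _).trans (le_max_left _ _)))).1
  have hRc : c 0 ≤ R := (le_abs_self _).trans (le_max_right _ _)
  have hR0 : 0 ≤ R := (abs_nonneg _).trans (le_max_right _ _)
  let N : ℝ := (2 * R + 2) / (- u 0)
  have hN : N * u 0 = - (2 * R + 2) := by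
    simp only [N]; field_simp [hu0.ne]
  let S : Set E3 := (fun s : ℝ => c + s • (N • u)) '' Set.Icc 0 1
  have hSc : IsCompact S := isCompact_Icc.image (by fun_prop)
  have hSd : Disjoint S L := by
    rw [Set.disjoint_left]
    rintro _ ⟨s, -, rfl⟩
    have := hray (s * N)
    rwa [mul_smul] at this
  obtain ⟨δ, hδ, hδ'⟩ := Metric.exists_pos_forall_lt_edist hSc hLc.isClosed hSd
  have hsep : ∀ t ∈ Set.Icc (0:ℝ) 1, ∀ y ∈ L, (δ:ℝ) < ‖c + t • (N • u) - y‖ := by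
    intro t ht y hy
    have := hδ' _ ⟨t, ht, rfl⟩ y hy
    rw [edist_nndist, ENNReal.coe_lt_coe] at this
    rw [← dist_eq_norm]
    exact_mod_cast this
  have hδR : (0:ℝ) < δ := by exact_mod_cast hδ
  obtain ⟨B, hB⟩ := (hK.image (show Continuous (fun x : E3 => x - c) by fun_prop)).isBounded.exists_norm_le
  have hB' : ∀ x ∈ K, ‖x - c‖ ≤ max B 0 := fun x hx => (hB _ ⟨x, hx, rfl⟩).trans (le_max_left _ _)
  let lam : ℝ := min 1 (δ / (max B 0 + 1))
  have hB0 : 0 ≤ max B 0 := le_max_right _ _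
  have hlam : 0 < lam := lt_min one_pos (by positivity)
  have hlam1 : lam ≤ 1 := min_le_left _ _
  have hlamB : ∀ x ∈ K, lam * ‖x - c‖ ≤ δ := by
    intro x hx
    calc lam * ‖x - c‖ ≤ (δ / (max B 0 + 1)) * (max B 0 + 1) :=
          mul_le_mul (min_le_right _ _) ((hB' x hx).trans (by linarith)) (norm_nonneg _) (by positivity)
      _ = δ := by field_simp
  -- shrink
  let w1 : E3 →ᵃ[ℝ] E3 := (lam - 1) • (AffineMap.id ℝ E3 - AffineMap.const ℝ E3 c)
  have hw1 : ∀ x, w1 x = (lam - 1) • (x - c) := fun x => by simp [w1]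
  refine path_move isoInv_split w1 hK hLc.isClosed ?_ ?_ ?_
  · intro t ht x y hxy
    simp only [hw1] at hxy
    have h1 : (1 - t * (1 - lam)) • (x - y) = 0 := by
      have : (1 - t * (1 - lam)) • (x - y) =
        (x + t • (lam - 1) • (x - c)) - (y + t • (lam - 1) • (y - c)) := by module
      rw [this, hxy, sub_self]
    have h2 : 1 - t * (1 - lam) ≠ 0 := by nlinarith [ht.1, ht.2]
    exact sub_eq_zero.1 ((smul_eq_zero.1 h1).resolve_left h2)
  · intro t ht x hx
    apply hd
    have : x + t • w1 x = (1 - t * (1 - lam)) • x + (t * (1 - lam)) • c := by rw [hw1]; module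
    rw [this]
    exact hT (hKT hx) hc (by nlinarith [ht.1, ht.2]) (mul_nonneg ht.1 (by linarith)) (by ring)
  -- translate
  refine path_move isoInv_split (AffineMap.const ℝ E3 (N • u)) ?_ hLc.isClosed ?_ ?_ ?_
  · refine hK.image ?_
    simp only [hw1]; fun_prop
  · intro t ht x y hxy
    simpa using hxy
  · rintro t ht _ ⟨x, hx, rfl⟩ hL
    have h1 := hsep t ht _ hL
    have h2 : c + t • (N • u) - (x + w1 x + t • (AffineMap.const ℝ E3 (N • u)) (x + w1 x)) =
        - (lam • (x - c)) := by
      rw [hw1, AffineMap.const_apply]; module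
    simp only [h2, norm_neg, norm_smul, Real.norm_eq_abs, abs_of_pos hlam] at h1
    linarith [hlamB x hx]
  · apply half_space_split (-R - 1)
    · rintro _ ⟨_, ⟨x, hx, rfl⟩, rfl⟩
      have h1 := hRK x hx
      simp only [hw1, AffineMap.const_apply, PiLp.add_apply, PiLp.smul_apply, PiLp.sub_apply, smul_eq_mul, hN]
      nlinarith
    · intro x hx
      have := hRL x hx
      linarith

/-- the linear functional `det3 a b` -/
def detL (a b : E3) : E3 →ₗ[ℝ] ℝ where
  toFun := det3 a b
  map_add' x y := by simp only [det3, PiLp.add_apply]; ring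
  map_smul' r x := by simp only [det3, PiLp.smul_apply, smul_eq_mul, RingHom.id_apply]; ring

lemma o4_detL (p q r x : E3) : o4 p q r x = detL (q - p) (r - p) (x - p) := rfl

lemma image_cycle4 (f : E3 →ᵃ[ℝ] E3) (D E F G : E3) :
    f '' cycle4 D E F G = cycle4 (f D) (f E) (f F) (f G) := by
  simp only [cycle4, Set.image_union, image_segment]

/-- moving the vertex `E` of a quadrilateral towards the plane of the others -/
lemma vertex_move {K : Set E3} (hK : IsClosed K) {D E F G M : E3} (hne : o4 D F G E ≠ 0)
    (hM : o4 D F G M = 0) {τ : ℝ} (h0 : 0 ≤ τ) (h1 : τ < 1)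
    (hdis : ∀ r ∈ Set.Icc 0 τ, ∀ x ∈ cycle4 D (E + r • (M - E)) F G, x ∉ K)
    (h : SplitLink K (cycle4 D (E + τ • (M - E)) F G)) : SplitLink K (cycle4 D E F G) := by
  let φ := detL (F - D) (G - D)
  let u : E3 := (τ * (o4 D F G E)⁻¹) • (M - E)
  let w : E3 →ᵃ[ℝ] E3 := (φ.smulRight u).toAffineMap.comp (AffineMap.id ℝ E3 - AffineMap.const ℝ E3 D)
  have hw : ∀ x, w x = o4 D F G x • u := fun x => by simp [w, o4_detL, φ]
  have hφu : φ u = - τ := by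
    have e : φ (M - E) = - o4 D F G E := by
      have : M - E = (M - D) - (E - D) := by abel
      rw [this, map_sub]
      change o4 D F G M - o4 D F G E = _
      rw [hM, zero_sub]
    simp only [u, map_smul, smul_eq_mul, e]
    field_simp
  have hwD : w D = 0 := by rw [hw, o4_self14, zero_smul]
  have hwF : w F = 0 := by rw [hw, o4_self24, zero_smul]
  have hwG : w G = 0 := by rw [hw, o4_self34, zero_smul]
  have hwE : w E = τ • (M - E) := by
    rw [hw]; simp only [u, smul_smul]; congr 1; field_simp
  have him : ∀ t : ℝ, (fun x => x + t • w x) '' cycle4 D E F G =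
      cycle4 D (E + (t * τ) • (M - E)) F G := by
    intro t
    have e : (fun x => x + t • w x) = ⇑(AffineMap.id ℝ E3 + t • w) := by ext x; simp
    rw [e, image_cycle4]
    simp [hwD, hwE, hwF, hwG, smul_smul]
  refine path_move (isoInv_flip isoInv_split) w (isCompact_cycle4 D E F G) hK ?_ ?_ ?_
  · intro t ht x y hxy
    have e1 : (x - y) = - (t * φ (x - y)) • u := by
      have e2 : o4 D F G x - o4 D F G y = φ (x - y) := by
        rw [o4_detL, o4_detL, ← map_sub]; congr 1; abel
      have e3 : x - y = (t * (o4 D F G y - o4 D F G x)) • u := by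
        simp only [hw] at hxy
        have : x - y = (x + t • o4 D F G x • u) - (y + t • o4 D F G y • u) -
          t • o4 D F G x • u + t • o4 D F G y • u := by abel
        rw [this, hxy]; module
      rw [← e2]; refine e3.trans ?_; congr 1; ring
    have e4 : φ (x - y) * (1 - t * τ) = 0 := by
      have := congrArg φ e1
      rw [map_smul, hφu, smul_eq_mul] at this
      linarith
    have e5 : 1 - t * τ ≠ 0 := by nlinarith [ht.1, ht.2]
    have e6 := (mul_eq_zero.1 e4).resolve_right e5
    rw [e6, mul_zero, neg_zero, zero_smul] at e1
    exact sub_eq_zero.1 e1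
  · intro t ht x hx
    apply hdis (t * τ) ⟨mul_nonneg ht.1 h0, by nlinarith [ht.1, ht.2]⟩
    rw [← him]
    exact ⟨x, hx, rfl⟩
  · have := him 1
    simp only [one_smul, one_mul] at this
    rw [this]
    exact h

lemma closedTri_o4 {A B C x : E3} (h : x ∈ ClosedTri A B C) : o4 A B C x = 0 := by
  obtain ⟨a, b, c, -, -, -, hs, rfl⟩ := h
  rw [o4_comb3 _ _ _ _ _ _ _ _ _ hs, o4_self14, o4_self24, o4_self34]; ring

lemma openTri_closedTri {A B C : E3} : OpenTri A B C ⊆ ClosedTri A B C := by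
  rintro x ⟨a, b, c, ha, hb, hc, h⟩
  exact ⟨a, b, c, ha.le, hb.le, hc.le, h⟩

lemma convex_openTri (A B C : E3) : Convex ℝ (OpenTri A B C) := by
  rintro _ ⟨a, b, c, ha, hb, hc, hs, rfl⟩ _ ⟨a', b', c', ha', hb', hc', hs', rfl⟩ s t hs0 ht0 hst
  have pos : ∀ x y : ℝ, 0 < x → 0 < y → 0 < s * x + t * y := by
    intro x y hx hy
    rcases hs0.eq_or_lt with h | h
    · have : t = 1 := by linarith
      rw [← h, this]; linarith
    · have := mul_pos h hx
      have := mul_nonneg ht0 hy.le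
      linarith
  refine ⟨_, _, _, pos a a' ha ha', pos b b' hb hb', pos c c' hc hc', ?_, ?_⟩
  · linear_combination s * hs + t * hs' + hst
  · module

lemma convex_closedTri (A B C : E3) : Convex ℝ (ClosedTri A B C) := by
  rintro _ ⟨a, b, c, ha, hb, hc, hs, rfl⟩ _ ⟨a', b', c', ha', hb', hc', hs', rfl⟩ s t hs0 ht0 hst
  refine ⟨s * a + t * a', s * b + t * b', s * c + t * c', by positivity, by positivity, by positivity, ?_, ?_⟩
  · linear_combination s * hs + t * hs' + hst
  · module

lemma cycle3_closedTri (A B C : E3) : cycle3 A B C ⊆ ClosedTri A B C := by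
  rintro x ((⟨s, t, hs, ht, hst, rfl⟩ | ⟨s, t, hs, ht, hst, rfl⟩) | ⟨s, t, hs, ht, hst, rfl⟩)
  · exact ⟨s, t, 0, hs, ht, le_rfl, by linarith, by module⟩
  · exact ⟨0, s, t, le_rfl, hs, ht, by linarith, by module⟩
  · exact ⟨t, 0, s, ht, le_rfl, hs, by linarith, by module⟩

lemma seg_not_open {A B C E x : E3} (hE : o4 A B C E ≠ 0) (hx : x ∈ segment ℝ A B)
    {a b c : ℝ} (hs : a + b + c = 1) (he : x = a • A + b • B + c • C) (hc : 0 < c) : False := by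
  obtain ⟨s, t, -, -, hst, rfl⟩ := hx
  have h1 := o4_comb2 A B E A B s t hst
  rw [he, o4_comb3 _ _ _ _ _ _ _ _ _ hs, o4_self14, o4_self24, o4_swap34] at h1
  have : c * o4 A B C E = 0 := by linarith
  rcases mul_eq_zero.1 this with h | h
  · exact hc.ne' h
  · exact hE h

lemma openTri_not_cycle3 {A B C E x : E3} (hE : o4 A B C E ≠ 0) (hx : x ∈ OpenTri A B C) :
    x ∉ cycle3 A B C := by
  obtain ⟨a, b, c, ha, hb, hc, hs, he⟩ := hx
  have hE2 : o4 B C A E ≠ 0 := by rw [o4_swap23, o4_swap12, neg_neg]; exact hE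
  have hE3 : o4 C A B E ≠ 0 := by rw [o4_swap12, o4_swap23, neg_neg]; exact hE
  rintro ((h | h) | h)
  · exact seg_not_open hE h hs he hc
  · exact seg_not_open hE2 h (a := b) (b := c) (c := a) (by linarith) (by rw [he]; abel) ha
  · exact seg_not_open hE3 h (a := c) (b := a) (c := b) (by linarith) (by rw [he]; abel) hb

/-- a point of a triangle `X V Y` on the zero set of an affine function -/
lemma core_pt {X V Y P Q x : E3} {hX hV hY s1 t1 s2 t2 α β γ : ℝ} (h0 : hV ≠ 0)
    (hs1 : s1 ≠ 0) (hs2 : s2 ≠ 0) (e1 : s1 + t1 = 1) (e2 : s2 + t2 = 1)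
    (z1 : s1 * hX + t1 * hV = 0) (z2 : s2 * hY + t2 * hV = 0)
    (hP : P = s1 • X + t1 • V) (hQ : Q = s2 • Y + t2 • V)
    (e3 : α + β + γ = 1) (z3 : α * hX + β * hV + γ * hY = 0) (hx : x = α • X + β • V + γ • Y) :
    α / s1 + γ / s2 = 1 ∧ x = (α / s1) • P + (γ / s2) • Q := by
  have hb : α / s1 * t1 + γ / s2 * t2 = β := by
    have : (α / s1 * t1 + γ / s2 * t2 - β) * hV = 0 := by
      have i1 : α / s1 * t1 * hV = - α * hX := by
        field_simp; linear_combination α * z1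
      have i2 : γ / s2 * t2 * hV = - γ * hY := by
        field_simp; linear_combination γ * z2
      linear_combination i1 + i2 - z3
    have := (mul_eq_zero.1 this).resolve_right h0
    linarith
  have ha : α / s1 * s1 = α := by field_simp
  have hc : γ / s2 * s2 = γ := by field_simp
  constructor
  · have : α / s1 + γ / s2 = α / s1 * (s1 + t1) + γ / s2 * (s2 + t2) := by rw [e1, e2]; ring
    rw [this]; linear_combination ha + hc + hb + e3
  · rw [hP, hQ, hx]
    conv_lhs => rw [← ha, ← hc, ← hb]
    module

/-- the segment misses the closed triangle -/
def Misses (A B C X Y : E3) : Prop := ∀ x ∈ segment ℝ X Y, x ∉ ClosedTri A B C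

lemma Misses.symm {A B C X Y : E3} (h : Misses A B C X Y) : Misses A B C Y X := by
  intro x hx; rw [segment_symm] at hx; exact h x hx

lemma Misses.avoid {A B C X Y : E3} (h : Misses A B C X Y) : ∀ x ∈ segment ℝ X Y, x ∉ cycle3 A B C :=
  fun x hx hx' => h x hx (cycle3_closedTri _ _ _ hx')

lemma Pierces.symm {A B C X Y : E3} (h : Pierces A B C X Y) : Pierces A B C Y X := by
  unfold Pierces at *; rwa [openSegment_symm]

lemma misses_of_pos {A B C X Y : E3} (h : 0 < o4 A B C X * o4 A B C Y) : Misses A B C X Y := by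
  rintro x ⟨s, t, hs, ht, hst, rfl⟩ hx
  have := closedTri_o4 hx
  rw [o4_comb2 _ _ _ _ _ _ _ hst] at this
  set a := o4 A B C X
  set b := o4 A B C Y
  have h1 : s * (a * b) + t * (b * b) = 0 := by linear_combination b * this
  have h2 : s * (a * a) + t * (a * b) = 0 := by linear_combination a * this
  have h3 : 0 ≤ s * (a * b) := mul_nonneg hs h.le
  have h4 : 0 ≤ t * (a * b) := mul_nonneg ht h.le
  have h5 : 0 ≤ s * (a * a) := mul_nonneg hs (mul_self_nonneg _)
  have h6 : 0 ≤ t * (b * b) := mul_nonneg ht (mul_self_nonneg _)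
  have : a * b = 0 := by
    have : (s + t) * (a * b) = 0 := by linarith
    rwa [hst, one_mul] at this
  linarith

/-- data of a piercing point -/
lemma pierce_data {A B C X V : E3} (h : Pierces A B C X V) :
    ∃ (P : E3) (s t : ℝ), P ∈ OpenTri A B C ∧ 0 < s ∧ 0 < t ∧ s + t = 1 ∧ P = s • X + t • V ∧
      s * o4 A B C X + t * o4 A B C V = 0 := by
  obtain ⟨P, ⟨s, t, hs, ht, hst, e⟩, hP⟩ := h
  refine ⟨P, s, t, hP, hs, ht, hst, e.symm, ?_⟩
  rw [← o4_comb2 _ _ _ _ _ _ _ hst, e]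
  exact closedTri_o4 (openTri_closedTri hP)

lemma pierces_avoid {A B C X V : E3} (h : Pierces A B C X V) (hV : o4 A B C V ≠ 0) :
    ∀ x ∈ segment ℝ X V, x ∉ cycle3 A B C := by
  obtain ⟨P, s, t, hP, hs, ht, hst, e, z⟩ := pierce_data h
  rintro x ⟨α, β, hα, hβ, hαβ, rfl⟩ hx
  have h0 := closedTri_o4 (cycle3_closedTri _ _ _ hx)
  rw [o4_comb2 _ _ _ _ _ _ _ hαβ] at h0
  obtain ⟨h1, h2⟩ := core_pt (γ := 0) hV hs.ne' hs.ne' hst hst z z e e (by linarith) (by linarith)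
    (show α • X + β • V = α • X + β • V + (0:ℝ) • X by simp)
  rw [zero_div, add_zero] at h1
  rw [h1, zero_div, zero_smul, one_smul, add_zero] at h2
  rw [h2] at hx
  exact openTri_not_cycle3 hV hP hx

lemma mem_cycle4_avoid {K : Set E3} {D E F G : E3} (h1 : ∀ x ∈ segment ℝ D E, x ∉ K)
    (h2 : ∀ x ∈ segment ℝ E F, x ∉ K) (h3 : ∀ x ∈ segment ℝ F G, x ∉ K)
    (h4 : ∀ x ∈ segment ℝ G D, x ∉ K) : ∀ x ∈ cycle4 D E F G, x ∉ K := by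
  rintro x (((h | h) | h) | h)
  · exact h1 x h
  · exact h2 x h
  · exact h3 x h
  · exact h4 x h

lemma all_miss_split {A B C D E F G : E3} (h1 : Misses A B C D E) (h2 : Misses A B C E F)
    (h3 : Misses A B C F G) (h4 : Misses A B C G D) : SplitLink (cycle3 A B C) (cycle4 D E F G) := by
  refine disjoint_split (isCompact_cycle3 A B C) (convex_closedTri A B C) (cycle3_closedTri A B C)
    (c := A) ⟨1, 0, 0, by norm_num, le_rfl, le_rfl, by norm_num, by simp⟩ ?_
  intro x hx hx'
  exact mem_cycle4_avoid h1 h2 h3 h4 x hx' hx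

lemma o4_move (p q r x y : E3) (t : ℝ) :
    o4 p q r (x + t • (y - x)) = (1 - t) * o4 p q r x + t * o4 p q r y := by
  have : x + t • (y - x) = (1 - t) • x + t • y := by module
  rw [this, o4_comb2 _ _ _ _ _ _ _ (by ring)]

/-- remove two adjacent crossings -/
lemma reduce_adj {A B C D E F G : E3} (hDE : Pierces A B C D E) (hEF : Pierces A B C E F)
    (sD : o4 A B C D * o4 A B C E < 0) (sF : o4 A B C F * o4 A B C E < 0)
    (hne : o4 D F G E ≠ 0) (hFG : ∀ x ∈ segment ℝ F G, x ∉ cycle3 A B C)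
    (hGD : ∀ x ∈ segment ℝ G D, x ∉ cycle3 A B C) :
    ∃ E', Misses A B C D E' ∧ Misses A B C E' F ∧ o4 D F G E' ≠ 0 ∧
      (SplitLink (cycle3 A B C) (cycle4 D E' F G) → SplitLink (cycle3 A B C) (cycle4 D E F G)) := by
  obtain ⟨P, s1, t1, hP, hs1, ht1, hst1, e1, z1⟩ := pierce_data hDE
  obtain ⟨Q, s2, t2, hQ, hs2, ht2, hst2, e2, z2⟩ := pierce_data hEF.symm
  have hE : o4 A B C E ≠ 0 := by intro h; rw [h, mul_zero] at sD; exact lt_irrefl _ sD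
  let M : E3 := (1/2 : ℝ) • D + (1/2 : ℝ) • F
  have hM0 : o4 D F G M = 0 := by
    rw [o4_comb2 _ _ _ _ _ _ _ (by norm_num), o4_self14, o4_self24]; ring
  set oD := o4 A B C D
  set oE := o4 A B C E
  set oF := o4 A B C F
  set m := (1/2) * oD + (1/2) * oF with hm
  have hMm : o4 A B C M = m := o4_comb2 _ _ _ _ _ _ _ (by norm_num)
  have hmE : m * oE < 0 := by rw [hm]; linarith
  have hEE : 0 < oE * oE := mul_self_pos.2 hE
  let k := m * oE
  let τ : ℝ := (k / 2 - oE * oE) / (k - oE * oE)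
  have hden : k - oE * oE < 0 := by simp only [k]; linarith
  have hk : k < 0 := hmE
  have hτ0 : 0 ≤ τ := div_nonneg_of_nonpos (by linarith) hden.le
  have hτ1 : τ < 1 := by
    rw [div_lt_one_of_neg hden]; linarith
  have hτe : (1 - τ) * oE + τ * m = m / 2 := by
    have h1 : ((1 - τ) * oE + τ * m - m / 2) * oE = 0 := by
      have h2 : τ * (k - oE * oE) = k / 2 - oE * oE := div_mul_cancel₀ _ hden.ne
      simp only [k] at h2
      linear_combination h2
    have := (mul_eq_zero.1 h1).resolve_right hE
    linarith
  have hE' : o4 A B C (E + τ • (M - E)) = m / 2 := by rw [o4_move, hMm]; exact hτe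
  have pos : ∀ o : ℝ, o * oE < 0 → 0 < o * (m / 2) := by
    intro o ho
    have h1 := mul_pos_of_neg_of_neg ho hmE
    have h2 : 0 < (o * (m / 2)) * (oE * oE) := by linarith
    exact (mul_pos_iff_of_pos_right hEE).1 h2
  have hull : ∀ x : E3, ∀ α β γ : ℝ, 0 ≤ α → 0 ≤ γ → α + β + γ = 1 → x = α • D + β • E + γ • F →
      x ∉ cycle3 A B C := by
    intro x α β γ hα hγ hs he hx
    have h0 := closedTri_o4 (cycle3_closedTri _ _ _ hx)
    rw [he, o4_comb3 _ _ _ _ _ _ _ _ _ hs] at h0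
    obtain ⟨h1, h2⟩ := core_pt hE hs1.ne' hs2.ne' hst1 hst2 z1 z2 e1 e2 hs h0 he
    have : x ∈ OpenTri A B C := by
      rw [h2]
      exact convex_openTri A B C hP hQ (by positivity) (by positivity) h1
    exact openTri_not_cycle3 hE this hx
  refine ⟨E + τ • (M - E), ?_, ?_, ?_, ?_⟩
  · apply misses_of_pos; rw [hE']; exact pos _ sD
  · apply Misses.symm; apply misses_of_pos; rw [hE']; exact pos _ sF
  · rw [o4_move, hM0]
    have : (1 - τ) ≠ 0 := by linarith
    simpa using ⟨this, hne⟩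
  · refine vertex_move (isCompact_cycle3 A B C).isClosed hne hM0 hτ0 hτ1 ?_
    intro r hr
    refine mem_cycle4_avoid ?_ ?_ hFG hGD
    · rintro x ⟨s, t, hs, ht, hst, rfl⟩
      refine hull _ (s + t * r / 2) (t * (1 - r)) (t * r / 2) ?_ ?_ ?_ ?_
      · have := mul_nonneg ht hr.1; linarith
      · have := mul_nonneg ht hr.1; linarith
      · linear_combination hst
      · simp only [M]; module
    · rintro x ⟨s, t, hs, ht, hst, rfl⟩
      refine hull _ (s * r / 2) (s * (1 - r)) (t + s * r / 2) ?_ ?_ ?_ ?_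
      · have := mul_nonneg hs hr.1; linarith
      · have := mul_nonneg hs hr.1; linarith
      · linear_combination hst
      · simp only [M]; module

lemma split_adj {A B C D E F G : E3} (hDE : Pierces A B C D E) (hEF : Pierces A B C E F)
    (sD : o4 A B C D * o4 A B C E < 0) (sF : o4 A B C F * o4 A B C E < 0)
    (hne : o4 D F G E ≠ 0) (hFG : Misses A B C F G) (hGD : Misses A B C G D) :
    SplitLink (cycle3 A B C) (cycle4 D E F G) := by
  obtain ⟨E', h1, h2, -, h⟩ := reduce_adj hDE hEF sD sF hne hFG.avoid hGD.avoid
  exact h (all_miss_split h1 h2 hFG hGD)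

lemma cycle4_rot (D E F G : E3) : cycle4 D E F G = cycle4 E F G D := by
  unfold cycle4; ext x; simp only [Set.mem_union]; tauto

lemma split_four {A B C D E F G : E3} (hDE : Pierces A B C D E) (hEF : Pierces A B C E F)
    (hFG : Pierces A B C F G) (hGD : Pierces A B C G D)
    (sD : o4 A B C D * o4 A B C E < 0) (sF : o4 A B C F * o4 A B C E < 0)
    (sG : o4 A B C F * o4 A B C G < 0) (sG' : o4 A B C D * o4 A B C G < 0)
    (hne : o4 D F G E ≠ 0) : SplitLink (cycle3 A B C) (cycle4 D E F G) := by
  have hG : o4 A B C G ≠ 0 := by intro h; rw [h, mul_zero] at sG; exact lt_irrefl _ sG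
  have hD : o4 A B C D ≠ 0 := by intro h; rw [h, zero_mul] at sD; exact lt_irrefl _ sD
  obtain ⟨E', h1, h2, h3, h⟩ := reduce_adj hDE hEF sD sF hne (pierces_avoid hFG hG)
    (pierces_avoid hGD hD)
  apply h
  rw [cycle4_rot, cycle4_rot]
  refine split_adj hFG hGD sG sG' ?_ h1 h2
  rw [o4_swap12, o4_swap34, neg_neg]; exact h3

lemma near_one {a a' : ℝ} (ha : 0 < a) : ∃ ε > 0, ∀ q, 0 ≤ q → q ≤ ε → 0 < (1 - q) * a + q * a' := by
  refine ⟨a / (2 * (a + |a'|)), by positivity, fun q h0 h1 => ?_⟩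
  have h2 : q * (a + |a'|) ≤ a / 2 := by
    calc q * (a + |a'|) ≤ a / (2 * (a + |a'|)) * (a + |a'|) :=
          mul_le_mul_of_nonneg_right h1 (by positivity)
      _ = a / 2 := by field_simp
  have h3 : - (q * |a'|) ≤ q * a' := by
    rw [← mul_neg]; exact mul_le_mul_of_nonneg_left (neg_abs_le _) h0
  linarith

lemma openTri_near {A B C P R : E3} (hP : P ∈ OpenTri A B C) {a' b' c' : ℝ} (hs' : a' + b' + c' = 1)
    (hR : R = a' • A + b' • B + c' • C) :
    ∃ ε : ℝ, 0 < ε ∧ ε ≤ 1 ∧ ∀ q : ℝ, 0 ≤ q → q ≤ ε → (1 - q) • P + q • R ∈ OpenTri A B C := by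
  obtain ⟨a, b, c, ha, hb, hc, hs, rfl⟩ := hP
  obtain ⟨ε1, h1, k1⟩ := near_one (a' := a') ha
  obtain ⟨ε2, h2, k2⟩ := near_one (a' := b') hb
  obtain ⟨ε3, h3, k3⟩ := near_one (a' := c') hc
  refine ⟨min (min ε1 ε2) (min ε3 1), by positivity, (min_le_right _ _).trans (min_le_right _ _),
    fun q h0 hq => ?_⟩
  simp only [le_min_iff] at hq
  refine ⟨_, _, _, k1 q h0 hq.1.1, k2 q h0 hq.1.2, k3 q h0 hq.2.1, ?_, ?_⟩
  · linear_combination (1 - q) * hs + q * hs'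
  · rw [hR]; module

lemma o4_perm (p q r s : E3) : o4 s r p q = - o4 p q r s := by
  unfold o4 det3
  simp only [PiLp.sub_apply]
  ring

/-- two opposite crossings of opposite sign -/
lemma split_opp {A B C D E F G : E3} (hDE : Pierces A B C D E) (hFG : Pierces A B C F G)
    (sDE : o4 A B C D * o4 A B C E < 0) (sDF : o4 A B C D * o4 A B C F < 0)
    (sGF : o4 A B C G * o4 A B C F < 0) (hGD : Misses A B C G D)
    (hne : o4 D F G E ≠ 0) (gp : EdgeGP A B C F D) :
    SplitLink (cycle3 A B C) (cycle4 D E F G) := by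
  obtain ⟨P, s1, t1, hP, hs1, ht1, hst1, e1, z1⟩ := pierce_data hDE.symm
  have hD := gp.hY
  have hF := gp.hX
  set oD := o4 A B C D with hoD
  set oE := o4 A B C E with hoE
  set oF := o4 A B C F with hoF
  have hDD : 0 < oD * oD := mul_self_pos.2 hD
  obtain ⟨e, he, heE⟩ : ∃ e : ℝ, 0 < e ∧ oE = - e * oD := by
    refine ⟨-(oD * oE) / (oD * oD), div_pos (by linarith) hDD, ?_⟩
    field_simp
  obtain ⟨f, hf, hfF⟩ : ∃ f : ℝ, 0 < f ∧ oF = - f * oD := by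
    refine ⟨-(oD * oF) / (oD * oD), div_pos (by linarith) hDD, ?_⟩
    field_simp
  -- the point R
  let s2 : ℝ := 1 / (1 + f)
  let t2 : ℝ := f / (1 + f)
  have hs2 : 0 < s2 := by positivity
  have ht2 : 0 < t2 := by positivity
  have hst2 : s2 + t2 = 1 := by simp only [s2, t2]; field_simp
  have z2 : s2 * oF + t2 * oD = 0 := by simp only [s2, t2, hfF]; field_simp; ring
  obtain ⟨a, b, c, habc, hR, -, -, -, -⟩ := cross_pt hF hD gp.h1 gp.h2 gp.h3
    (x := s2 • F + t2 • D) ⟨s2, t2, hs2.le, ht2.le, hst2, rfl⟩ (by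
      rw [o4_comb2 _ _ _ _ _ _ _ hst2]; exact z2)
  obtain ⟨q0, hq0, hq1, hq⟩ := openTri_near hP habc hR
  let κ : ℝ := q0 * s2 * f
  have hκ : 0 < κ := by positivity
  have hκ1 : κ < 1 := by
    have h1 : s2 * f < 1 := by simp only [s2]; rw [one_div_mul_eq_div, div_lt_one (by positivity)]; linarith
    have h2 : 0 < s2 * f := by positivity
    have : κ = q0 * (s2 * f) := by simp only [κ]; ring
    rw [this]
    calc q0 * (s2 * f) ≤ 1 * (s2 * f) := mul_le_mul_of_nonneg_right hq1 h2.le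
      _ < 1 := by linarith
  let τ : ℝ := (κ + e) / (1 + e)
  have hτ0 : 0 ≤ τ := by positivity
  have hτ1 : τ < 1 := by rw [div_lt_one (by positivity)]; linarith
  have hτe : - e + τ * (1 + e) = κ := by simp only [τ]; field_simp; ring
  have hoEr : ∀ r, o4 A B C (E + r • (D - E)) = (- e + r * (1 + e)) * oD := by
    intro r
    rw [o4_move, ← hoE, ← hoD, heE]; ring
  have hull : ∀ x : E3, ∀ α β γ : ℝ, o4 A B C x = 0 → 0 ≤ γ → γ ≤ q0 * s2 → α + β + γ = 1 →
      x = α • E + β • D + γ • F → x ∈ OpenTri A B C := by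
    intro x α β γ h0 hγ hγ' hs hx
    rw [hx, o4_comb3 _ _ _ _ _ _ _ _ _ hs] at h0
    obtain ⟨h1, h2⟩ := core_pt hD hs1.ne' hs2.ne' hst1 hst2 z1 z2 e1 rfl hs h0 hx
    have h3 : α / s1 = 1 - γ / s2 := by linarith
    rw [h2, h3]
    apply hq _ (by positivity)
    rw [div_le_iff₀ hs2]; exact hγ'
  have bound : ∀ r s t : ℝ, r ≤ τ → 0 ≤ s → 0 ≤ t → s + t = 1 →
      o4 A B C (s • (E + r • (D - E)) + t • F) = 0 → t ≤ q0 * s2 := by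
    intro r s t hr hs ht hst h0
    rw [o4_comb2 _ _ _ _ _ _ _ hst, hoEr, ← hoF, hfF] at h0
    have h1 : (s * (-e + r * (1 + e)) - t * f) * oD = 0 := by linear_combination h0
    have h2 := (mul_eq_zero.1 h1).resolve_right hD
    have h3 : -e + r * (1 + e) ≤ κ := by
      rw [← hτe]; have := mul_le_mul_of_nonneg_right hr (show 0 ≤ 1 + e by linarith); linarith
    have h4 : s * (-e + r * (1 + e)) ≤ 1 * κ := by
      calc _ ≤ s * κ := mul_le_mul_of_nonneg_left h3 hs
        _ ≤ _ := mul_le_mul_of_nonneg_right (by linarith) hκ.le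
    have h5 : t * f ≤ (q0 * s2) * f := by simp only [κ] at h4; linarith
    exact le_of_mul_le_mul_right h5 hf
  have hGne : o4 A B C G ≠ 0 := by intro h; rw [h, zero_mul] at sGF; exact lt_irrefl _ sGF
  have hMD : o4 D F G D = 0 := o4_self14 _ _ _
  refine vertex_move (isCompact_cycle3 A B C).isClosed hne hMD hτ0 hτ1 ?_ ?_
  · intro r hr
    refine mem_cycle4_avoid ?_ ?_ (pierces_avoid hFG hGne) hGD.avoid
    · rintro x ⟨s, t, hs, ht, hst, rfl⟩ hx
      have h0 := closedTri_o4 (cycle3_closedTri _ _ _ hx)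
      refine openTri_not_cycle3 hD (hull _ (t * (1 - r)) (s + t * r) 0 h0 le_rfl (by positivity) ?_ ?_) hx
      · linear_combination hst
      · module
    · rintro x ⟨s, t, hs, ht, hst, rfl⟩ hx
      have h0 := closedTri_o4 (cycle3_closedTri _ _ _ hx)
      refine openTri_not_cycle3 hD (hull _ (s * (1 - r)) (s * r) t h0 ht
        (bound r s t hr.2 hs ht hst h0) ?_ ?_) hx
      · linear_combination hst
      · module
  · have hoE' : o4 A B C (E + τ • (D - E)) = κ * oD := by rw [hoEr, hτe]
    rw [cycle4_rot]
    refine split_adj ?_ hFG ?_ sGF ?_ hGD ?_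
    · let s : ℝ := f / (f + κ)
      let t : ℝ := κ / (f + κ)
      have hs : 0 < s := by positivity
      have ht : 0 < t := by positivity
      have hst : s + t = 1 := by simp only [s, t]; field_simp
      have h0 : o4 A B C (s • (E + τ • (D - E)) + t • F) = 0 := by
        rw [o4_comb2 _ _ _ _ _ _ _ hst, hoE', ← hoF, hfF]
        simp only [s, t]; ring
      refine ⟨s • (E + τ • (D - E)) + t • F, ⟨s, t, hs, ht, hst, rfl⟩, ?_⟩
      refine hull _ (s * (1 - τ)) (s * τ) t h0 ht.le (bound τ s t le_rfl hs.le ht.le hst h0) ?_ ?_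
      · linear_combination hst
      · module
    · rw [hoE', ← hoF, mul_assoc]
      exact mul_neg_of_pos_of_neg hκ sDF
    · rw [o4_perm, neg_ne_zero, o4_move, hMD]
      have : (1 - τ) ≠ 0 := by linarith
      simpa using ⟨this, hne⟩
    · apply misses_of_pos
      rw [hoE', ← hoD]
      have := mul_pos hκ hDD
      linarith

lemma miss_of_not_pierce {A B C X Y : E3} (g : EdgeGP A B C X Y) (h : ¬ Pierces A B C X Y) :
    Misses A B C X Y := fun x hx hx' =>
  h (closed_meet_pierces g.hX g.hY g.h1 g.h2 g.h3 ⟨x, hx, hx'⟩)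

lemma pierce_sign {A B C X Y : E3} (g : EdgeGP A B C X Y) (h : Pierces A B C X Y) :
    o4 A B C X * o4 A B C Y < 0 := by
  obtain ⟨P, s, t, -, hs, ht, -, -, z⟩ := pierce_data h
  have hX := mul_self_pos.2 g.hX
  have h1 : t * (o4 A B C X * o4 A B C Y) < 0 := by
    have : t * (o4 A B C X * o4 A B C Y) = - (s * (o4 A B C X * o4 A B C X)) := by
      linear_combination o4 A B C X * z
    rw [this]; have := mul_pos hs hX; linarith
  by_contra h2
  have := mul_nonneg ht.le (not_lt.1 h2)
  linarith

lemma edgeSign_pierced {A B C X Y : E3} (h : Pierces A B C X Y) :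
    edgeSign A B C X Y = if 0 < o4 A B C X then 1 else -1 := by
  unfold edgeSign; rw [if_pos h]; rfl

lemma edgeSign_not {A B C X Y : E3} (h : ¬ Pierces A B C X Y) : edgeSign A B C X Y = 0 := by
  unfold edgeSign; rw [if_neg h]

lemma sign_opp {x y : ℝ} (hy : y ≠ 0)
    (h : (if 0 < x then (1:ℤ) else -1) + (if 0 < y then 1 else -1) = 0) : x ≠ 0 → x * y < 0 := by
  intro hx
  rcases lt_or_gt_of_ne hx with h1 | h1 <;> rcases lt_or_gt_of_ne hy with h2 | h2
  · rw [if_neg h1.not_gt, if_neg h2.not_gt] at h; norm_num at h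
  · exact mul_neg_of_neg_of_pos h1 h2
  · exact mul_neg_of_pos_of_neg h1 h2
  · rw [if_pos h1, if_pos h2] at h; norm_num at h

lemma same_of_opp {x y z : ℝ} (h1 : x * y < 0) (h2 : y * z < 0) : 0 < x * z := by
  have hy : 0 < y * y := mul_self_pos.2 (by rintro rfl; simp at h1)
  have := mul_pos_of_neg_of_neg h1 h2
  have h3 : 0 < (x * z) * (y * y) := by linarith
  exact (mul_pos_iff_of_pos_right hy).1 h3

lemma opp_of_same {x y z : ℝ} (h1 : 0 < x * y) (h2 : y * z < 0) : x * z < 0 := by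
  have h3 : 0 < x * (-z) := same_of_opp (y := -y) (by linarith) (by linarith)
  linarith

theorem lk_zero_split {A B C D E F G : E3} (g1 : EdgeGP A B C D E) (g2 : EdgeGP A B C E F)
    (g3 : EdgeGP A B C F G) (g4 : EdgeGP A B C G D) (g5 : EdgeGP A B C F D) (g6 : EdgeGP A B C G E)
    (hne : o4 D F G E ≠ 0) (h : lkTriQuad A B C D E F G = 0) :
    SplitLink (cycle3 A B C) (cycle4 D E F G) := by
  have n2 : o4 E G D F ≠ 0 := by rw [o4_perm]; exact neg_ne_zero.2 hne
  have n3 : o4 F D E G ≠ 0 := by rw [o4_perm]; exact neg_ne_zero.2 n2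
  have n4 : o4 G E F D ≠ 0 := by rw [o4_perm]; exact neg_ne_zero.2 n3
  unfold lkTriQuad at h
  have par : ∀ (x : ℝ), (if 0 < x then (1:ℤ) else -1) = 1 ∨ (if 0 < x then (1:ℤ) else -1) = -1 := by
    intro x; split_ifs <;> simp
  have pD := par (o4 A B C D)
  have pE := par (o4 A B C E)
  have pF := par (o4 A B C F)
  have pG := par (o4 A B C G)
  by_cases h1 : Pierces A B C D E <;> by_cases h2 : Pierces A B C E F <;>
    by_cases h3 : Pierces A B C F G <;> by_cases h4 : Pierces A B C G D <;>
    simp only [edgeSign_pierced, edgeSign_not, h1, h2, h3, h4, not_false_eq_true] at h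
  · have s1 := pierce_sign g1 h1
    have s2 := pierce_sign g2 h2
    have s3 := pierce_sign g3 h3
    have s4 := pierce_sign g4 h4
    exact split_four h1 h2 h3 h4 s1 (by linarith) s3 (by linarith) hne
  · omega
  · omega
  · have s1 := pierce_sign g1 h1
    have s2 := pierce_sign g2 h2
    exact split_adj h1 h2 s1 (by linarith) hne (miss_of_not_pierce g3 h3) (miss_of_not_pierce g4 h4)
  · omega
  · have s1 := pierce_sign g1 h1
    have s3 := pierce_sign g3 h3
    have s := sign_opp g3.hX (by linarith) g1.hX
    exact split_opp h1 h3 s1 s (by linarith) (miss_of_not_pierce g4 h4) hne g5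
  · have s1 := pierce_sign g1 h1
    have s4 := pierce_sign g4 h4
    rw [cycle4_rot, cycle4_rot, cycle4_rot]
    exact split_adj h4 h1 s4 (by linarith) n4 (miss_of_not_pierce g2 h2) (miss_of_not_pierce g3 h3)
  · omega
  · omega
  · have s3 := pierce_sign g3 h3
    have s2 := pierce_sign g2 h2
    rw [cycle4_rot]
    exact split_adj h2 h3 s2 (by linarith) n2 (miss_of_not_pierce g4 h4) (miss_of_not_pierce g1 h1)
  · have s2 := pierce_sign g2 h2
    have s4 := pierce_sign g4 h4
    have s := sign_opp g4.hX (by linarith) g2.hX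
    rw [cycle4_rot]
    exact split_opp h2 h4 s2 s (by linarith) (miss_of_not_pierce g1 h1) n2 g6
  · omega
  · have s3 := pierce_sign g3 h3
    have s4 := pierce_sign g4 h4
    rw [cycle4_rot, cycle4_rot]
    exact split_adj h3 h4 s3 (by linarith) n3 (miss_of_not_pierce g1 h1) (miss_of_not_pierce g2 h2)
  · omega
  · omega
  · exact all_miss_split (miss_of_not_pierce g1 h1) (miss_of_not_pierce g2 h2)
      (miss_of_not_pierce g3 h3) (miss_of_not_pierce g4 h4)

lemma nodup_all2 : ∀ a b : Fin 3,
    [6, odds a, evens b, odds (a+2), odds (a+1)].Nodup ∧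
    [6, odds a, evens b, evens (b+2), evens (b+1)].Nodup := by decide

theorem linkCount_eq {v : Fin 7 → E3} (hv : GenPos7 v) :
    linkCount v = (Finset.univ.filter fun p : Fin 3 × Fin 3 => lk331 v p.1 p.2 ≠ 0).card := by
  unfold linkCount
  congr 1
  apply Finset.filter_congr
  rintro ⟨a, b⟩ -
  rw [not_iff_not]
  refine ⟨split_lk331 hv a b, fun h => ?_⟩
  obtain ⟨n1, n2, n3, n4⟩ := nodup_all a b
  obtain ⟨n5, n6⟩ := nodup_all2 a b
  refine lk_zero_split (edgeGP_of hv _ _ _ _ _ n1) (edgeGP_of hv _ _ _ _ _ n2)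
    (edgeGP_of hv _ _ _ _ _ n3) (edgeGP_of hv _ _ _ _ _ n4) (edgeGP_of hv _ _ _ _ _ n5)
    (edgeGP_of hv _ _ _ _ _ n6) ?_ h
  exact gp_o4 hv _ _ _ _ (odds_ne _ _ (fin3_12 a)) (odds_ne_evens _ _) (odds_ne_evens _ _)
    (odds_ne_evens _ _) (odds_ne_evens _ _) (evens_ne _ _ (fin3_12 b).symm)

/-- integer point configuration made real -/
def ptsOf (w : Fin 7 → Fin 3 → ℤ) : Fin 7 → E3 := fun i => WithLp.toLp 2 fun j => (w i j : ℝ)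

/-- integer orientation determinant -/
def o4Z (p q r s : Fin 3 → ℤ) : ℤ :=
  (q 0 - p 0) * ((r 1 - p 1) * (s 2 - p 2) - (r 2 - p 2) * (s 1 - p 1))
    - (q 1 - p 1) * ((r 0 - p 0) * (s 2 - p 2) - (r 2 - p 2) * (s 0 - p 0))
    + (q 2 - p 2) * ((r 0 - p 0) * (s 1 - p 1) - (r 1 - p 1) * (s 0 - p 0))

lemma o4_cast (w : Fin 7 → Fin 3 → ℤ) (i j k l : Fin 7) :
    o4 (ptsOf w i) (ptsOf w j) (ptsOf w k) (ptsOf w l) = ((o4Z (w i) (w j) (w k) (w l) : ℤ) : ℝ) := by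
  simp only [o4, det3, o4Z, ptsOf, PiLp.sub_apply]
  push_cast
  ring

lemma example_count (w : Fin 7 → Fin 3 → ℤ) (n : ℕ)
    (hg : ∀ i j k l : Fin 7, i ≠ j → i ≠ k → i ≠ l → j ≠ k → j ≠ l → k ≠ l →
      o4Z (w i) (w j) (w k) (w l) ≠ 0)
    (hn : total
      (fun i j => decide (0 < o4Z (w 6) (w (odds (i+1))) (w (odds (i+2))) (w (evens j))))
      (fun i j => decide (0 < o4Z (w 6) (w (odds i)) (w (evens (j+1))) (w (evens (j+2)))))
      (fun i j => decide (0 < o4Z (w (odds (i+1))) (w (odds (i+2))) (w (evens (j+1))) (w (evens (j+2)))))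
      = n) :
    ∃ v : Fin 7 → E3, GenPos7 v ∧ linkCount v = n := by
  have hv : GenPos7 (ptsOf w) := by
    intro i j k l h1 h2 h3 h4 h5 h6
    rw [affInd_iff_o4, o4_cast]
    exact_mod_cast hg i j k l h1 h2 h3 h4 h5 h6
  refine ⟨ptsOf w, hv, ?_⟩
  rw [linkCount_eq hv, lk_count hv, ← hn]
  congr 1 <;> funext i j <;> simp only [sm, sb, Td, Ud, Dd, o4_cast, Int.cast_pos]

lemma ex1 : ∃ v : Fin 7 → E3, GenPos7 v ∧ linkCount v = 1 :=
  example_count ![![1,2,2],![1,2,1],![2,-1,0],![2,2,2],![-1,-2,-2],![-2,0,-2],![-2,-1,1]] 1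
    (by decide +kernel) (by decide +kernel)

lemma ex2 : ∃ v : Fin 7 → E3, GenPos7 v ∧ linkCount v = 2 :=
  example_count ![![-2,-1,1],![1,1,-2],![-2,0,-2],![0,0,2],![-2,-2,-1],![0,-2,1],![0,1,-2]] 2
    (by decide +kernel) (by decide +kernel)

lemma ex3 : ∃ v : Fin 7 → E3, GenPos7 v ∧ linkCount v = 3 :=
  example_count ![![2,-1,-1],![-1,-2,1],![0,0,2],![-2,2,0],![1,2,-1],![0,-1,0],![-1,1,2]] 3
    (by decide +kernel) (by decide +kernel)

lemma ex4 : ∃ v : Fin 7 → E3, GenPos7 v ∧ linkCount v = 4 :=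
  example_count ![![0,0,2],![1,-1,2],![-1,1,0],![2,-1,-1],![-2,1,2],![1,-2,-2],![2,0,0]] 4
    (by decide +kernel) (by decide +kernel)

lemma ex5 : ∃ v : Fin 7 → E3, GenPos7 v ∧ linkCount v = 5 :=
  example_count ![![-2,-1,1],![1,1,1],![-1,-1,0],![1,1,-2],![1,-2,2],![-1,2,2],![2,0,-2]] 5
    (by decide +kernel) (by decide +kernel)

lemma linkCount_bounds {v : Fin 7 → E3} (hv : GenPos7 v) : 1 ≤ linkCount v ∧ linkCount v ≤ 5 := by
  rw [linkCount_eq hv, lk_count hv]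
  exact total_bounds (valid_geom hv)

/-- No linear embedding of `K₃,₃,₁` contains more than five nontrivial
2-component links; moreover, a linear embedding of `K₃,₃,₁` with exactly `n`
nontrivial 2-component links exists if and only if `n ∈ {1, 2, 3, 4, 5}`. -/
theorem linkCount_le_five_and_characterization :
    (∀ v : Fin 7 → E3, GenPos7 v → linkCount v ≤ 5) ∧
    ∀ n : ℕ, (∃ v : Fin 7 → E3, GenPos7 v ∧ linkCount v = n) ↔
      n ∈ ({1, 2, 3, 4, 5} : Set ℕ) := by
  refine ⟨fun v hv => (linkCount_bounds hv).2, fun n => ⟨?_, ?_⟩⟩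
  · rintro ⟨v, hv, rfl⟩
    have h := linkCount_bounds hv
    simp only [Set.mem_insert_iff, Set.mem_singleton_iff]
    omega
  · intro hn
    simp only [Set.mem_insert_iff, Set.mem_singleton_iff] at hn
    rcases hn with rfl | rfl | rfl | rfl | rfl
    · exact ex1
    · exact ex2
    · exact ex3
    · exact ex4
    · exact ex5

end
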